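/- arXiv:2509.11309 — 5 statements merged into one kernel-verified Lean document; each statement's English description precedes it below -/
import Mathlib

section
/- Let n ≥ 1, x̃ ∈ ℝ², and let (α_{ij})_{1 ≤ i ≠ j ≤ n} be nonnegative integers. For λ ∈ (0, e^{-1}] set ℓ_n := ⨍_{B_λ} ⋯ ⨍_{B_λ} ∏_{i=1}^n (1 + |log |x_i − x̃||) · ∏_{i ≠ j} (1 + |log |x_i − x_j||)^{α_{ij}} dx₁ ⋯ dxₙ. Then there is a constant C, depending only on n and the α_{ij}, such that ℓ_n ≤ C · |log λ|^{Σ_{i≠j} α_{ij}} · (1 + ⨍_{B_λ} |log |x − x̃||² dx)^{n/2}. -/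
open MeasureTheory Real

namespace LogConv

abbrev E2 := EuclideanSpace ℝ (Fin 2)

lemma inv_ball {R : ℝ} (hR : 0 < R) :
    IntegrableOn (fun z : E2 => ‖z‖⁻¹) (Metric.ball 0 R) ∧
    ∫ z in Metric.ball (0 : E2) R, ‖z‖⁻¹ = 2 * volume.real (Metric.ball (0 : E2) 1) * R := by
  constructor
  · rw [integrableOn_fun_norm_addHaar volume (f := fun r => r⁻¹)]
    have : IntegrableOn (fun _ : ℝ => (1 : ℝ)) (Set.Ioo 0 R) := by simp
    refine this.congr_fun ?_ measurableSet_Ioo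
    intro y hy
    have : y ≠ 0 := hy.1.ne'
    simp [this]
  · rw [← integral_indicator measurableSet_ball]
    have h1 : (Metric.ball (0 : E2) R).indicator (fun z : E2 => ‖z‖⁻¹)
        = fun z => (Set.Iio R).indicator (fun r => r⁻¹) ‖z‖ := by
      funext z
      simp [Set.indicator]
    rw [h1, integral_fun_norm_addHaar volume]
    have h2 : ∫ y in Set.Ioi (0 : ℝ), y ^ (Module.finrank ℝ E2 - 1) •
        (Set.Iio R).indicator (fun r : ℝ => r⁻¹) y = R := by
      have h3 : ∫ y in Set.Ioi (0 : ℝ), y ^ (Module.finrank ℝ E2 - 1) •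
        (Set.Iio R).indicator (fun r : ℝ => r⁻¹) y
          = ∫ y in Set.Ioi (0 : ℝ), (Set.Iio R).indicator (fun _ : ℝ => (1 : ℝ)) y := by
        refine setIntegral_congr_fun measurableSet_Ioi ?_
        intro y hy
        have hy' : y ≠ 0 := ne_of_gt hy
        by_cases h : y < R <;> simp [Set.indicator, h, hy']
      rw [h3, setIntegral_indicator measurableSet_Iio, Set.Ioi_inter_Iio]
      simp [hR.le]
    rw [h2]
    simp [mul_assoc]

lemma inv_shift {R : ℝ} (hR : 0 < R) (y : E2) :
    IntegrableOn (fun z : E2 => ‖z - y‖⁻¹) (Metric.ball y R) ∧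
    ∫ z in Metric.ball y R, ‖z - y‖⁻¹ = 2 * volume.real (Metric.ball (0 : E2) 1) * R := by
  have hp : (fun z : E2 => z - y) ⁻¹' Metric.ball 0 R = Metric.ball y R := by
    ext z; simp [dist_eq_norm]
  have hm := measurePreserving_sub_right (volume : Measure E2) y
  have he : MeasurableEmbedding (fun z : E2 => z - y) := measurableEmbedding_subRight y
  obtain ⟨h1, h2⟩ := inv_ball hR
  rw [← hp]
  constructor
  · exact (hm.integrableOn_comp_preimage he).2 h1
  · rw [← h2]
    exact hm.setIntegral_preimage_emb he (fun z => ‖z‖⁻¹) _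

lemma inv_on {R : ℝ} (hR : 0 < R) (y : E2) :
    IntegrableOn (fun z : E2 => ‖z - y‖⁻¹) (Metric.ball 0 R) := by
  refine (inv_shift (R := R + ‖y‖) (by positivity) y).1.mono_set ?_
  intro z hz
  simp only [Metric.mem_ball, dist_eq_norm, sub_zero] at *
  linarith [norm_sub_le z y]

lemma inv_le {R : ℝ} (hR : 0 < R) {y : E2} (hy : y ∈ Metric.ball 0 R) :
    ∫ z in Metric.ball 0 R, ‖z - y‖⁻¹ ≤ 4 * volume.real (Metric.ball (0 : E2) 1) * R := by
  obtain ⟨h1, h2⟩ := inv_shift (R := 2 * R) (by positivity) y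
  calc _ ≤ ∫ z in Metric.ball y (2*R), ‖z - y‖⁻¹ := by
        refine setIntegral_mono_set h1 (.of_forall fun z => by positivity) ?_
        refine Filter.Eventually.of_forall ?_
        intro z hz
        change z ∈ Metric.ball (0 : E2) R at hz
        change z ∈ Metric.ball y (2 * R)
        simp only [Metric.mem_ball, dist_eq_norm, sub_zero] at *
        linarith [norm_sub_le z y]
    _ = _ := by rw [h2]; ring

lemma vol_ball {R : ℝ} (hR : 0 < R) :
    volume.real (Metric.ball (0 : E2) R) = R ^ 2 * volume.real (Metric.ball (0 : E2) 1) := by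
  simp only [Measure.real]
  rw [Measure.addHaar_ball_of_pos volume _ hR]
  simp [hR.le]

/-- two-point bound -/
lemma pair (n : ℕ) {R : ℝ} (hR : 0 < R) (i j : Fin n) :
    Integrable (fun x : Fin n → E2 => (‖x i - x j‖ / R)⁻¹)
      (Measure.pi fun _ => volume.restrict (Metric.ball (0 : E2) R)) ∧
    ∫ x : Fin n → E2, (‖x i - x j‖ / R)⁻¹
      ∂(Measure.pi fun _ => volume.restrict (Metric.ball (0 : E2) R))
      ≤ 4 * volume.real (Metric.ball (0 : E2) R) ^ n := by
  by_cases hij : i = j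
  · subst hij
    simp
  obtain ⟨m, rfl⟩ : ∃ m, n = m + 1 := ⟨n - 1, by have := i.2; omega⟩
  obtain ⟨k, rfl⟩ := Fin.exists_succAbove_eq (Ne.symm hij)
  set μ : Measure E2 := volume.restrict (Metric.ball (0 : E2) R) with hμ
  have hmp := measurePreserving_piFinSuccAbove (fun _ : Fin (m+1) => μ) i
  have hmeas : Measurable (fun x : Fin (m+1) → E2 => (‖x i - x (i.succAbove k)‖ / R)⁻¹) := by
    fun_prop
  set V := volume.real (Metric.ball (0 : E2) R) with hV
  have hle : ∫⁻ x : Fin (m+1) → E2, ENNReal.ofReal ((‖x i - x (i.succAbove k)‖ / R)⁻¹)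
      ∂(Measure.pi fun _ => μ) ≤ ENNReal.ofReal (4 * V ^ (m+1)) := by
    have e1 : ∫⁻ x : Fin (m+1) → E2, ENNReal.ofReal ((‖x i - x (i.succAbove k)‖ / R)⁻¹)
      ∂(Measure.pi fun _ => μ) = ∫⁻ p : E2 × (Fin m → E2), ENNReal.ofReal ((‖p.1 - p.2 k‖ / R)⁻¹)
        ∂(μ.prod (Measure.pi fun _ => μ)) := by
      rw [← hmp.lintegral_comp (by fun_prop)]
      rfl
    rw [e1, lintegral_prod_symm' _ (by fun_prop)]
    have hae : ∀ᵐ y : Fin m → E2 ∂(Measure.pi fun _ => μ), y k ∈ Metric.ball (0 : E2) R := by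
      have : ∀ᵐ z ∂μ, z ∈ Metric.ball (0 : E2) R := ae_restrict_mem measurableSet_ball
      exact (Measure.quasiMeasurePreserving_eval (fun _ : Fin m => μ) k).ae this
    calc _ ≤ ∫⁻ y : Fin m → E2, ENNReal.ofReal (4 * V) ∂(Measure.pi fun _ => μ) := by
          refine lintegral_mono_ae ?_
          filter_upwards [hae] with y hy
          have hi : Integrable (fun z : E2 => (‖z - y k‖ / R)⁻¹) μ := by
            have := (inv_on hR (y k)).mul_const R
            refine this.congr (.of_forall fun z => ?_)
            simp [div_eq_mul_inv, mul_comm]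
          rw [← ofReal_integral_eq_lintegral_ofReal hi (.of_forall fun z => by positivity)]
          refine ENNReal.ofReal_le_ofReal ?_
          have e2 : ∫ z, (‖z - y k‖ / R)⁻¹ ∂μ = R * ∫ z, (‖z - y k‖)⁻¹ ∂μ := by
            rw [← integral_const_mul]
            congr 1; funext z
            simp [div_eq_mul_inv, mul_comm]
          rw [e2, hV, vol_ball hR]
          have := mul_le_mul_of_nonneg_left (inv_le hR hy) hR.le
          linarith
      _ = ENNReal.ofReal (4 * V ^ (m+1)) := by
          have hμu : μ Set.univ = ENNReal.ofReal V := by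
            rw [hμ, hV, Measure.restrict_apply_univ, ofReal_measureReal measure_ball_lt_top.ne]
          have hV0 : 0 ≤ V := measureReal_nonneg
          rw [lintegral_const, Measure.pi_univ]
          simp only [hμu, Finset.prod_const, Finset.card_univ, Fintype.card_fin]
          rw [← ENNReal.ofReal_pow hV0, ← ENNReal.ofReal_mul (by positivity)]
          congr 1; ring
  have hnn : ∀ x : Fin (m+1) → E2, 0 ≤ (‖x i - x (i.succAbove k)‖ / R)⁻¹ := fun x => by positivity
  have hV0 : 0 ≤ V := measureReal_nonneg
  constructor
  · refine ⟨hmeas.aestronglyMeasurable, ?_⟩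
    rw [hasFiniteIntegral_iff_ofReal (.of_forall hnn)]
    exact hle.trans_lt ENNReal.ofReal_lt_top
  · rw [integral_eq_lintegral_of_nonneg_ae (.of_forall hnn) hmeas.aestronglyMeasurable]
    exact ENNReal.toReal_le_of_le_ofReal (by positivity) hle

lemma log_pow (k : ℕ) {s : ℝ} (hs : 0 ≤ s) :
    (2 + |log s|) ^ k ≤ (k.factorial * exp 2) * (1 + s + s⁻¹) := by
  have h1 : (2 + |log s|) ^ k ≤ k.factorial * exp (2 + |log s|) := by
    have := Real.pow_div_factorial_le_exp (2 + |log s|) (by positivity) k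
    rw [div_le_iff₀ (by positivity)] at this
    linarith
  have h2 : exp |log s| ≤ 1 + s + s⁻¹ := by
    rcases hs.eq_or_lt with rfl | h
    · simp
    · have hi : 0 < s⁻¹ := by positivity
      rcases abs_cases (log s) with ⟨h3, _⟩ | ⟨h3, _⟩
      · rw [h3, exp_log h]; linarith
      · rw [h3, exp_neg, exp_log h]; linarith
  rw [exp_add] at h1
  refine h1.trans ?_
  rw [mul_assoc]
  gcongr

lemma log_scale {r lam : ℝ} (hr : 0 ≤ r) (hl : 0 < lam) (hl1 : lam ≤ exp (-1)) :
    1 + |log r| ≤ |log lam| * (2 + |log (r / lam)|) := by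
  have hlog : log lam ≤ -1 := by
    have := log_le_log hl hl1
    rwa [log_exp] at this
  have hL : 1 ≤ |log lam| := by rw [abs_of_neg (by linarith)]; linarith
  rcases hr.eq_or_lt with rfl | h
  · simp; linarith
  · have h1 : log r = log (r / lam) + log lam := by
      rw [log_div h.ne' hl.ne']; ring
    have h2 : |log r| ≤ |log (r / lam)| + |log lam| := by rw [h1]; exact abs_add_le _ _
    nlinarith [abs_nonneg (log (r / lam))]

lemma log_sq_int {R : ℝ} (hR : 0 < R) (y : E2) :
    IntegrableOn (fun z : E2 => |log ‖z - y‖| ^ 2) (Metric.ball 0 R) := by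
  have hg : IntegrableOn (fun z : E2 => ((2 : ℕ).factorial * exp 2) *
      (1 + (R + ‖y‖) + ‖z - y‖⁻¹)) (Metric.ball 0 R) := by
    refine Integrable.const_mul ?_ _
    refine Integrable.add ?_ (inv_on hR y)
    exact integrableOn_const measure_ball_lt_top.ne
  refine Integrable.mono' hg (Measurable.aestronglyMeasurable (by measurability)) ?_
  filter_upwards [ae_restrict_mem measurableSet_ball] with z hz
  have hz' : ‖z‖ < R := by simpa using hz
  rw [norm_of_nonneg (by positivity)]
  calc |log ‖z - y‖| ^ 2 ≤ (2 + |log ‖z - y‖|) ^ 2 := by gcongr; linarith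
    _ ≤ _ := log_pow 2 (norm_nonneg _)
    _ ≤ _ := by
      gcongr
      linarith [norm_sub_le z y]

lemma one_add_int {R : ℝ} (hR : 0 < R) (y : E2) :
    Integrable (fun z : E2 => (1 + |log ‖z - y‖|) ^ 2)
      (volume.restrict (Metric.ball (0 : E2) R)) ∧
    ∫ z in Metric.ball (0 : E2) R, (1 + |log ‖z - y‖|) ^ 2 ≤
      2 * (volume.real (Metric.ball (0 : E2) R)
        + ∫ z in Metric.ball (0 : E2) R, |log ‖z - y‖| ^ 2) := by
  have hc : IntegrableOn (fun _ : E2 => (1 : ℝ)) (Metric.ball (0 : E2) R) :=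
    integrableOn_const measure_ball_lt_top.ne
  have hg : IntegrableOn (fun z : E2 => 2 * (1 + |log ‖z - y‖| ^ 2)) (Metric.ball 0 R) :=
    Integrable.const_mul (Integrable.add hc (log_sq_int hR y)) _
  have hp : ∀ z : E2, (1 + |log ‖z - y‖|) ^ 2 ≤ 2 * (1 + |log ‖z - y‖| ^ 2) := fun z => by
    nlinarith [sq_nonneg (1 - |log ‖z - y‖|)]
  have hi : Integrable (fun z : E2 => (1 + |log ‖z - y‖|) ^ 2)
      (volume.restrict (Metric.ball (0 : E2) R)) := by
    refine Integrable.mono' hg (Measurable.aestronglyMeasurable (by measurability)) (.of_forall fun z => ?_)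
    rw [norm_of_nonneg (by positivity)]
    exact hp z
  refine ⟨hi, (integral_mono hi hg hp).trans (le_of_eq ?_)⟩
  rw [integral_const_mul, integral_add hc (log_sq_int hR y)]
  simp

/-- pointwise bound of the pair product -/
lemma pointwise (n : ℕ) (hn : 1 ≤ n) (α : Fin n → Fin n → ℕ) {lam : ℝ} (hl : 0 < lam)
    (hl1 : lam ≤ exp (-1)) (N : ℕ) (hN : N = ∑ i, ∑ j, if i = j then 0 else α i j)
    (x : Fin n → E2) (hx : ∀ i, x i ∈ Metric.ball (0 : E2) lam) :
    (∏ i, ∏ j, if i = j then (1 : ℝ) else (1 + |log ‖x i - x j‖|) ^ α i j) ^ 2 ≤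
      (|log lam| ^ N) ^ 2 * (((2 * N).factorial * exp 2) *
        ∑ i, ∑ j, (3 + (‖x i - x j‖ / lam)⁻¹)) := by
  obtain ⟨p, -, hp⟩ := Finset.exists_max_image (Finset.univ : Finset (Fin n × Fin n))
    (fun p => 2 + |log (‖x p.1 - x p.2‖ / lam)|) ⟨(⟨0, hn⟩, ⟨0, hn⟩), Finset.mem_univ _⟩
  set G := 2 + |log (‖x p.1 - x p.2‖ / lam)| with hG
  have hG0 : 0 ≤ G := by positivity
  have h1 : (∏ i, ∏ j, if i = j then (1 : ℝ) else (1 + |log ‖x i - x j‖|) ^ α i j) ≤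
      (|log lam| * G) ^ N := by
    rw [hN, ← Finset.prod_pow_eq_pow_sum]
    simp_rw [← Finset.prod_pow_eq_pow_sum]
    refine Finset.prod_le_prod (fun i _ => Finset.prod_nonneg fun j _ => ?_) fun i _ =>
      Finset.prod_le_prod (fun j _ => ?_) fun j _ => ?_
    · split_ifs <;> positivity
    · split_ifs <;> positivity
    · split_ifs with h
      · simp
      · have := hp (i, j) (Finset.mem_univ _)
        gcongr
        exact (log_scale (norm_nonneg _) hl hl1).trans (by gcongr)
  have h0 : 0 ≤ (∏ i, ∏ j, if i = j then (1 : ℝ) else (1 + |log ‖x i - x j‖|) ^ α i j) :=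
    Finset.prod_nonneg fun i _ => Finset.prod_nonneg fun j _ => by split_ifs <;> positivity
  have hs : ‖x p.1 - x p.2‖ / lam ≤ 2 := by
    rw [div_le_iff₀ hl]
    have a := hx p.1
    have b := hx p.2
    simp only [Metric.mem_ball, dist_zero_right] at a b
    linarith [norm_sub_le (x p.1) (x p.2)]
  calc _ ≤ ((|log lam| * G) ^ N) ^ 2 := by gcongr
    _ = (|log lam| ^ N) ^ 2 * G ^ (2 * N) := by ring
    _ ≤ _ := by
      gcongr
      refine (log_pow (2 * N) (by positivity)).trans ?_
      gcongr
      calc 1 + ‖x p.1 - x p.2‖ / lam + (‖x p.1 - x p.2‖ / lam)⁻¹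
          ≤ 3 + (‖x p.1 - x p.2‖ / lam)⁻¹ := by linarith
        _ ≤ ∑ j, (3 + (‖x p.1 - x j‖ / lam)⁻¹) :=
            Finset.single_le_sum (f := fun j => 3 + (‖x p.1 - x j‖ / lam)⁻¹)
              (fun j _ => by positivity) (Finset.mem_univ p.2)
        _ ≤ _ := Finset.single_le_sum (f := fun i => ∑ j, (3 + (‖x i - x j‖ / lam)⁻¹))
              (fun i _ => by positivity) (Finset.mem_univ p.1)

end LogConv

open LogConv in
/-- Bound on general convolutions of logarithms: for `n ≥ 1`, `x̃ ∈ ℝ²` and nonnegative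
integers `(α_{ij})_{i≠j}`, the `n`-fold ball average
`ℓ_n = ⨍_{B_λ}ⁿ ∏_i (1+|log|x_i−x̃||) ∏_{i≠j} (1+|log|x_i−x_j||)^{α_{ij}}`
satisfies `ℓ_n ≤ C |log λ|^{Σα_{ij}} (1 + ⨍_{B_λ}|log|x−x̃||²)^{n/2}` for all `λ ∈ (0,e⁻¹]`,
with `C` depending only on `n` and the `α_{ij}`. -/
theorem stmt2 (n : ℕ) (hn : 1 ≤ n) (α : Fin n → Fin n → ℕ) :
    ∃ C : ℝ, ∀ (xt : EuclideanSpace ℝ (Fin 2)), ∀ lam ∈ Set.Ioc (0 : ℝ) (Real.exp (-1)),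
      ((volume (Metric.ball (0 : EuclideanSpace ℝ (Fin 2)) lam)).toReal ^ n)⁻¹ *
          (∫ x in Set.univ.pi fun _ : Fin n => Metric.ball (0 : EuclideanSpace ℝ (Fin 2)) lam,
            (∏ i, (1 + |Real.log ‖x i - xt‖|)) *
              ∏ i, ∏ j, if i = j then 1 else (1 + |Real.log ‖x i - x j‖|) ^ α i j)
        ≤ C * |Real.log lam| ^ (∑ i, ∑ j, if i = j then 0 else α i j) *
            (1 + ((volume (Metric.ball (0 : EuclideanSpace ℝ (Fin 2)) lam)).toReal)⁻¹ *
                ∫ x in Metric.ball (0 : EuclideanSpace ℝ (Fin 2)) lam, |Real.log ‖x - xt‖| ^ 2)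
              ^ ((n : ℝ) / 2) := by
  obtain ⟨N, hN⟩ : ∃ N, N = ∑ i, ∑ j, if i = j then 0 else α i j := ⟨_, rfl⟩
  rw [← hN]
  obtain ⟨D, hD⟩ : ∃ D : ℝ, D = (2 * N).factorial * exp 2 := ⟨_, rfl⟩
  have hD0 : 0 ≤ D := by rw [hD]; positivity
  refine ⟨(2 ^ n + D * (n * (n * 7))) / 2, ?_⟩
  rintro xt lam ⟨hl, hl1⟩
  set μ : Measure E2 := volume.restrict (Metric.ball (0 : E2) lam) with hμ
  have hr : (volume : Measure (Fin n → E2)).restrict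
      (Set.univ.pi fun _ : Fin n => Metric.ball (0 : E2) lam) = Measure.pi fun _ => μ := by
    rw [volume_pi, Measure.restrict_pi_pi]
  have hfin : IsFiniteMeasure μ := ⟨by rw [hμ, Measure.restrict_apply_univ]; exact measure_ball_lt_top⟩
  rw [hr]
  change (volume.real (Metric.ball (0 : E2) lam) ^ n)⁻¹ * _ ≤
    _ * (1 + (volume.real (Metric.ball (0 : E2) lam))⁻¹ * _) ^ ((n : ℝ) / 2)
  have hV0 : 0 < volume.real (Metric.ball (0 : E2) lam) :=
    ENNReal.toReal_pos (Metric.measure_ball_pos _ _ hl).ne' measure_ball_lt_top.ne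
  obtain ⟨hi1, hi2⟩ := one_add_int hl xt
  have hpair := fun i j => pair n hl i j
  rw [← hμ] at hi1 hi2 hpair
  have hun : (Measure.pi fun _ : Fin n => μ).real Set.univ =
      volume.real (Metric.ball (0 : E2) lam) ^ n := by
    simp [Measure.real, Measure.pi_univ, hμ]
  set V := volume.real (Metric.ball (0 : E2) lam) with hV
  set I := ∫ x, |log ‖x - xt‖| ^ 2 ∂μ with hI
  have hI0 : 0 ≤ I := integral_nonneg fun x => by positivity
  set S := 1 + V⁻¹ * I with hS
  have hS0 : 0 < S := by positivity
  set L := |log lam| with hL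
  have hLpos : 0 < L := by
    have := log_le_log hl hl1
    rw [log_exp] at this
    exact abs_pos.2 (by linarith)
  set T := S ^ ((n : ℝ) / 2) with hT
  have hT0 : 0 < T := by positivity
  have hT2 : T ^ 2 = S ^ n := by
    rw [hT, ← rpow_natCast (S ^ ((n : ℝ) / 2)), ← rpow_mul hS0.le, ← rpow_natCast]
    congr 1; push_cast; ring
  have hVS : V * S = V + I := by rw [hS]; field_simp
  -- the dominating function
  let g1 : (Fin n → E2) → ℝ := fun x => ∏ i, (1 + |log ‖x i - xt‖|) ^ 2
  let g2 : (Fin n → E2) → ℝ := fun x => ∑ i, ∑ j, (3 + (‖x i - x j‖ / lam)⁻¹)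
  have hg1 : Integrable g1 (Measure.pi fun _ => μ) := Integrable.fintype_prod fun _ => hi1
  have hterm : ∀ i j : Fin n, Integrable (fun x : Fin n → E2 => 3 + (‖x i - x j‖ / lam)⁻¹)
      (Measure.pi fun _ => μ) := fun i j => (integrable_const _).add (hpair i j).1
  have hg2 : Integrable g2 (Measure.pi fun _ => μ) :=
    integrable_finsetSum _ fun i _ => integrable_finsetSum _ fun j _ => hterm i j
  have hg1i : ∫ x, g1 x ∂(Measure.pi fun _ => μ) ≤ 2 ^ n * V ^ n * T ^ 2 := by
    have : ∫ x, g1 x ∂(Measure.pi fun _ => μ) = (∫ z, (1 + |log ‖z - xt‖|) ^ 2 ∂μ) ^ n := by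
      have := integral_fintype_prod_eq_pow (ι := Fin n) (μ := μ)
        (fun z : E2 => (1 + |log ‖z - xt‖|) ^ 2)
      simpa using this
    rw [this, hT2, ← mul_pow, ← mul_pow, mul_assoc, hVS]
    exact pow_le_pow_left₀ (integral_nonneg fun z => by positivity) hi2 n
  have hg2i : ∫ x, g2 x ∂(Measure.pi fun _ => μ) ≤ (n * (n * 7)) * V ^ n := by
    have e : ∫ x, g2 x ∂(Measure.pi fun _ => μ) = ∑ i, ∑ j,
        ∫ x : Fin n → E2, (3 + (‖x i - x j‖ / lam)⁻¹) ∂(Measure.pi fun _ => μ) := by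
      simp only [g2]
      rw [integral_finsetSum _ fun i _ => integrable_finsetSum _ fun j _ => hterm i j]
      refine Finset.sum_congr rfl fun i _ => ?_
      rw [integral_finsetSum _ fun j _ => hterm i j]
    rw [e]
    calc _ ≤ ∑ _i : Fin n, ∑ _j : Fin n, 7 * V ^ n := by
          refine Finset.sum_le_sum fun i _ => Finset.sum_le_sum fun j _ => ?_
          rw [integral_add (integrable_const _) (hpair i j).1, integral_const, hun, smul_eq_mul]
          linarith [(hpair i j).2]
      _ = _ := by simp; ring
  have hmain : ∫ x : Fin n → E2, (∏ i, (1 + |Real.log ‖x i - xt‖|)) *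
        (∏ i, ∏ j, if i = j then 1 else (1 + |Real.log ‖x i - x j‖|) ^ α i j)
        ∂(Measure.pi fun _ => μ) ≤
      ∫ x, (L ^ N * T / 2) * (g1 x / T ^ 2 + D * g2 x) ∂(Measure.pi fun _ => μ) := by
    refine integral_mono_of_nonneg (.of_forall fun x => ?_)
      (((hg1.div_const _).add (hg2.const_mul D)).const_mul _) ?_
    · exact mul_nonneg (Finset.prod_nonneg fun i _ => by positivity)
        (Finset.prod_nonneg fun i _ => Finset.prod_nonneg fun j _ => by split_ifs <;> positivity)
    · have hae : ∀ᵐ x : Fin n → E2 ∂(Measure.pi fun _ => μ),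
          ∀ i, x i ∈ Metric.ball (0 : E2) lam := by
        rw [ae_all_iff]
        intro i
        have : ∀ᵐ z ∂μ, z ∈ Metric.ball (0 : E2) lam := ae_restrict_mem measurableSet_ball
        exact (Measure.quasiMeasurePreserving_eval (fun _ : Fin n => μ) i).ae this
      filter_upwards [hae] with x hx
      have hP := pointwise n hn α hl hl1 N hN x hx
      rw [← hD] at hP
      change _ ≤ (L ^ N) ^ 2 * (D * g2 x) at hP
      have hA : g1 x = (∏ i, (1 + |log ‖x i - xt‖|)) ^ 2 := by
        simp only [g1]; rw [Finset.prod_pow]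
      rw [hA]
      generalize (∏ i, ∏ j, if i = j then (1 : ℝ) else (1 + |log ‖x i - x j‖|) ^ α i j) = P at hP ⊢
      generalize (∏ i, (1 + |log ‖x i - xt‖|)) = A
      have hM : 0 < L ^ N := by positivity
      generalize L ^ N = M at hP hM ⊢
      have h3 : (P / M) ^ 2 ≤ D * g2 x := by
        rw [div_pow, div_le_iff₀ (by positivity)]; linarith
      have h4 : A * P = (M * T / 2) * (2 * (A / T) * (P / M)) := by field_simp
      rw [h4]
      have h5 := two_mul_le_add_sq (A / T) (P / M)
      rw [div_pow] at h5
      gcongr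
      linarith
  rw [inv_mul_le_iff₀ (by positivity)]
  refine hmain.trans ?_
  rw [integral_const_mul, integral_add (hg1.div_const _) (hg2.const_mul D), integral_div,
    integral_const_mul]
  have h1 : (∫ x, g1 x ∂(Measure.pi fun _ => μ)) / T ^ 2 ≤ 2 ^ n * V ^ n := by
    rw [div_le_iff₀ (by positivity)]; exact hg1i
  calc _ ≤ (L ^ N * T / 2) * (2 ^ n * V ^ n + D * ((n * (n * 7)) * V ^ n)) := by gcongr
    _ = _ := by ring
end

section
/- Let N ≥ 1, n ≥ 1, v₁, …, vₙ ∈ ℝ^N, and let F : ℝ^N → ℝ be n times continuously differentiable such that for some C ≥ 0 and p ≥ 1, |F(x)| ≤ C(1 + |x|)^p and the operator norms of D^k F(x) are bounded by C(1 + |x|)^p for all x ∈ ℝ^N and 1 ≤ k ≤ n. Under γ_N, set X_i(x) := ⟨x, v_i⟩ for 1 ≤ i ≤ n (so that E[X_i X_j] = ⟨v_i, v_j⟩). Then E[ F · ⋄_{i=1}^{n} X_i ] = E[ D^n F (v₁, …, vₙ) ], where D^n F(x) is the n-th total derivative of F at x, viewed as an n-linear map. -/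
open MeasureTheory Real
open scoped RealInnerProductSpace

/-- The standard Gaussian probability measure on `ℝ^N` (centred, identity covariance),
given by its density `(2π)^{-N/2} exp(−|x|²/2)` with respect to Lebesgue measure. -/
noncomputable def stdGaussian (N : ℕ) : Measure (EuclideanSpace ℝ (Fin N)) :=
  volume.withDensity fun x =>
    ENNReal.ofReal ((2 * π) ^ (-(N : ℝ) / 2) * Real.exp (-‖x‖ ^ 2 / 2))

/-- The Wick product of a (reversed) list of random variables, defined recursively by
`⋄_{i=1}^0 X_i := 1` and
`⋄_{i=1}^n X_i := Xₙ ⋄_{i=1}^{n-1} X_i − Σ_{j<n} E[Xₙ X_j] ⋄_{ℓ≠j} X_ℓ`,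
where the head of the list plays the role of the last variable `Xₙ`. -/
noncomputable def wickRV {Ω : Type*} [MeasurableSpace Ω] (μ : Measure Ω) :
    List (Ω → ℝ) → Ω → ℝ
  | [], _ => 1
  | X :: l, ω =>
      X ω * wickRV μ l ω -
        ∑ j : Fin l.length, (∫ ω', X ω' * l.get j ω' ∂μ) * wickRV μ (l.eraseIdx j) ω
termination_by l => l.length
decreasing_by
  · simp
  · have h := List.length_eraseIdx_le l j
    simp only [List.length_cons]
    omega

namespace GaussWick

/-- Euclidean space. -/
abbrev E (N : ℕ) := EuclideanSpace ℝ (Fin N)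

/-- The Gaussian density. -/
noncomputable def rho (N : ℕ) (x : E N) : ℝ :=
  (2 * π) ^ (-(N : ℝ) / 2) * Real.exp (-‖x‖ ^ 2 / 2)

/-- Continuous functions of polynomial growth. -/
def PG {N : ℕ} (f : E N → ℝ) : Prop :=
  Continuous f ∧ ∃ (C : ℝ) (m : ℕ), 0 ≤ C ∧ ∀ x, |f x| ≤ C * (1 + ‖x‖) ^ m

lemma PG.const {N : ℕ} (c : ℝ) : PG (fun _ : E N => c) :=
  ⟨continuous_const, |c|, 0, abs_nonneg _, fun x => by simp⟩

lemma PG.inner {N : ℕ} (v : E N) : PG (fun x : E N => ⟪x, v⟫) := by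
  refine ⟨by fun_prop, ‖v‖, 1, norm_nonneg _, fun x => ?_⟩
  have := abs_real_inner_le_norm x v
  nlinarith [norm_nonneg v, norm_nonneg x]

lemma PG.mul {N : ℕ} {f g : E N → ℝ} (hf : PG f) (hg : PG g) : PG (fun x => f x * g x) := by
  obtain ⟨hf, C, m, hC, hfb⟩ := hf
  obtain ⟨hg, D, k, hD, hgb⟩ := hg
  refine ⟨hf.mul hg, C * D, m + k, by positivity, fun x => ?_⟩
  rw [abs_mul, pow_add]
  calc |f x| * |g x| ≤ (C * (1 + ‖x‖) ^ m) * (D * (1 + ‖x‖) ^ k) := by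
        gcongr
        · exact hfb x
        · exact hgb x
    _ = _ := by ring

lemma PG.add {N : ℕ} {f g : E N → ℝ} (hf : PG f) (hg : PG g) : PG (fun x => f x + g x) := by
  obtain ⟨hf, C, m, hC, hfb⟩ := hf
  obtain ⟨hg, D, k, hD, hgb⟩ := hg
  refine ⟨hf.add hg, C + D, m + k, by positivity, fun x => ?_⟩
  have h1 : (1 : ℝ) ≤ 1 + ‖x‖ := by linarith [norm_nonneg x]
  calc |f x + g x| ≤ |f x| + |g x| := abs_add_le _ _
    _ ≤ C * (1 + ‖x‖) ^ m + D * (1 + ‖x‖) ^ k := add_le_add (hfb x) (hgb x)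
    _ ≤ C * (1 + ‖x‖) ^ (m + k) + D * (1 + ‖x‖) ^ (m + k) := by
        gcongr <;> first | exact h1 | omega
    _ = _ := by ring

lemma PG.sub {N : ℕ} {f g : E N → ℝ} (hf : PG f) (hg : PG g) : PG (fun x => f x - g x) := by
  have := hf.add ((PG.const (-1)).mul hg)
  convert this using 2
  ring

lemma PG.sum {N : ℕ} {ι : Type*} (s : Finset ι) {f : ι → E N → ℝ} (hf : ∀ i, PG (f i)) :
    PG (fun x => ∑ i ∈ s, f i x) := by
  classical
  induction s using Finset.induction_on with
  | empty => simpa using PG.const (N := N) 0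
  | insert a s ha ih =>
    simp only [Finset.sum_insert ha]
    exact (hf a).add ih

lemma rho_cont (N : ℕ) : Continuous (rho N) := by
  unfold rho; fun_prop

lemma rho_nonneg (N : ℕ) (x : E N) : 0 ≤ rho N x := by
  unfold rho; positivity

lemma integrable_aux {N : ℕ} (m : ℕ) :
    Integrable (fun x : E N => (1 + ‖x‖) ^ m * Real.exp (-‖x‖ ^ 2 / 2)) := by
  have h0 : Integrable (fun x : E N => (1 + ‖x‖) ^ (-((N + 1 : ℕ) : ℝ))) :=
    integrable_one_add_norm (by simp)
  have h1 := h0.const_mul (((m + (N + 1)).factorial : ℝ) * Real.exp (3 / 2))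
  refine h1.mono' (by fun_prop) (Filter.Eventually.of_forall fun x => ?_)
  have ht : 0 ≤ ‖x‖ := norm_nonneg x
  have hp : 0 < 1 + ‖x‖ := by linarith
  rw [Real.norm_of_nonneg (by positivity), Real.rpow_neg hp.le, Real.rpow_natCast,
    ← div_eq_mul_inv, le_div_iff₀ (by positivity)]
  have h2 := Real.pow_div_factorial_le_exp (1 + ‖x‖) hp.le (m + (N + 1))
  rw [div_le_iff₀ (by positivity)] at h2
  calc (1 + ‖x‖) ^ m * Real.exp (-‖x‖ ^ 2 / 2) * (1 + ‖x‖) ^ (N + 1)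
      = (1 + ‖x‖) ^ (m + (N + 1)) * Real.exp (-‖x‖ ^ 2 / 2) := by rw [pow_add]; ring
    _ ≤ Real.exp (1 + ‖x‖) * ((m + (N + 1)).factorial : ℝ) * Real.exp (-‖x‖ ^ 2 / 2) := by gcongr
    _ = ((m + (N + 1)).factorial : ℝ) * Real.exp ((1 + ‖x‖) + -‖x‖ ^ 2 / 2) := by
        rw [Real.exp_add (1 + ‖x‖)]; ring
    _ ≤ _ := by
        gcongr
        nlinarith [sq_nonneg (‖x‖ - 1)]

lemma PG.integrable_mul_rho {N : ℕ} {f : E N → ℝ} (hf : PG f) :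
    Integrable (fun x => f x * rho N x) := by
  obtain ⟨hf, C, m, hC, hfb⟩ := hf
  have h1 := (integrable_aux (N := N) m).const_mul (C * (2 * π) ^ (-(N : ℝ) / 2))
  refine h1.mono' (hf.mul (rho_cont N)).aestronglyMeasurable
    (Filter.Eventually.of_forall fun x => ?_)
  rw [norm_mul, Real.norm_of_nonneg (rho_nonneg N x), Real.norm_eq_abs]
  calc |f x| * rho N x ≤ (C * (1 + ‖x‖) ^ m) * rho N x :=
        mul_le_mul_of_nonneg_right (hfb x) (rho_nonneg N x)
    _ = _ := by unfold rho; ring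

lemma gauss_eq (N : ℕ) :
    stdGaussian N = volume.withDensity fun x => ENNReal.ofReal (rho N x) := rfl

lemma integral_gauss {N : ℕ} (f : E N → ℝ) :
    ∫ x, f x ∂(stdGaussian N) = ∫ x, f x * rho N x := by
  rw [gauss_eq]
  rw [integral_withDensity_eq_integral_toReal_smul
    ((rho_cont N).measurable.ennreal_ofReal) (by simp)]
  refine integral_congr_ae (Filter.Eventually.of_forall fun x => ?_)
  have := ENNReal.toReal_ofReal (rho_nonneg N x)
  simp only [this, smul_eq_mul]
  ring

lemma PG.integrable {N : ℕ} {f : E N → ℝ} (hf : PG f) : Integrable f (stdGaussian N) := by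
  rw [gauss_eq]
  rw [integrable_withDensity_iff_integrable_smul'
    ((rho_cont N).measurable.ennreal_ofReal) (by simp)]
  refine hf.integrable_mul_rho.congr (Filter.Eventually.of_forall fun x => ?_)
  have := ENNReal.toReal_ofReal (rho_nonneg N x)
  simp only [this, smul_eq_mul]
  ring

lemma integral_one_gauss (N : ℕ) : ∫ _, (1 : ℝ) ∂(stdGaussian N) = 1 := by
  rw [integral_gauss]
  simp only [one_mul, rho]
  rw [integral_const_mul]
  have h := GaussianFourier.integral_rexp_neg_mul_sq_norm (V := E N) (b := 1 / 2) (by norm_num)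
  have h2 : ∀ x : E N, -‖x‖ ^ 2 / 2 = -(1 / 2) * ‖x‖ ^ 2 := fun x => by ring
  simp only [h2]
  rw [h, finrank_euclideanSpace_fin, div_div_eq_mul_div, div_one, mul_comm π 2,
    ← Real.rpow_add (by positivity)]
  simp [neg_div]

lemma rho_lineDeriv {N : ℕ} (v x : E N) :
    HasLineDerivAt ℝ (rho N) (-(⟪x, v⟫ * rho N x)) x v := by
  have h1 : HasFDerivAt (fun x : E N => ‖x‖ ^ 2) (2 • (innerSL ℝ x)) x :=
    (hasStrictFDerivAt_norm_sq x).hasFDerivAt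
  have h2 := (((h1.neg.mul_const (1 / 2 : ℝ)).exp).const_mul
    ((2 * π) ^ (-(N : ℝ) / 2))).hasLineDerivAt v
  convert! h2 using 1
  · funext y; simp only [rho, Pi.neg_apply]; congr 2; ring_nf
  · simp [rho]
    ring_nf

/-- Gaussian integration by parts. -/
lemma stein {N : ℕ} {f f' : E N → ℝ} (v : E N) (hf : PG f) (hf' : PG f')
    (hd : ∀ x, HasLineDerivAt ℝ f (f' x) x v) :
    ∫ x, f x * ⟪x, v⟫ ∂(stdGaussian N) = ∫ x, f' x ∂(stdGaussian N) := by
  rw [integral_gauss, integral_gauss]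
  have h := integral_bilinear_hasLineDerivAt_right_eq_neg_left_of_integrable
    (μ := (volume : Measure (E N))) (f := f) (f' := f') (g := rho N)
    (g' := fun x => -(⟪x, v⟫ * rho N x)) (v := v) (B := ContinuousLinearMap.mul ℝ ℝ)
    (by simpa using hf'.integrable_mul_rho)
    (by
      have := (hf.mul (PG.inner v)).integrable_mul_rho.neg
      refine this.congr (Filter.Eventually.of_forall fun x => ?_)
      simp [mul_assoc])
    (by simpa using hf.integrable_mul_rho)
    (fun x _ => hd x) (fun x _ => rho_lineDeriv v x)
  simp only [ContinuousLinearMap.mul_apply', mul_neg, integral_neg, neg_inj] at h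
  simpa only [mul_assoc] using h

lemma inner_lineDeriv {N : ℕ} (u v x : E N) :
    HasLineDerivAt ℝ (fun x : E N => ⟪x, u⟫) ⟪v, u⟫ x v := by
  have h : HasFDerivAt (fun x : E N => ⟪x, u⟫) (innerSL ℝ u) x := by
    have := (innerSL ℝ u).hasFDerivAt (x := x)
    convert! this using 1
    funext y; simp [real_inner_comm]
  convert! h.hasLineDerivAt v using 1
  simp [real_inner_comm]

lemma cov {N : ℕ} (u v : E N) : ∫ x, ⟪x, u⟫ * ⟪x, v⟫ ∂(stdGaussian N) = ⟪u, v⟫ := by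
  rw [stein v (PG.inner u) (PG.const ⟪v, u⟫) (fun x => inner_lineDeriv u v x)]
  have := integral_const_mul (μ := stdGaussian N) ⟪v, u⟫ (fun _ => (1 : ℝ))
  rw [integral_one_gauss] at this
  simpa [real_inner_comm] using this

/-- Sum over one removed entry of a list. -/
def T {α : Type*} (a : α → ℝ) (f : List α → ℝ) (l : List α) : ℝ :=
  ∑ j : Fin l.length, a (l.get j) * f (l.eraseIdx j)

lemma T_cons {α : Type*} (a : α → ℝ) (f : List α → ℝ) (w : α) (l : List α) :
    T a f (w :: l) = a w * f l + T a (fun m => f (w :: m)) l := by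
  unfold T
  simp [Fin.sum_univ_succ]

lemma T_add {α : Type*} (a : α → ℝ) (f g : List α → ℝ) (l : List α) :
    T a (fun m => f m + g m) l = T a f l + T a g l := by
  simp [T, mul_add, Finset.sum_add_distrib]

lemma T_sub {α : Type*} (a : α → ℝ) (f g : List α → ℝ) (l : List α) :
    T a (fun m => f m - g m) l = T a f l - T a g l := by
  simp [T, mul_sub, Finset.sum_sub_distrib]

lemma T_mul {α : Type*} (a : α → ℝ) (c : ℝ) (f : List α → ℝ) (l : List α) :
    T a (fun m => c * f m) l = c * T a f l := by
  simp only [T, Finset.mul_sum]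
  exact Finset.sum_congr rfl fun _ _ => by ring

lemma T_comm {α : Type*} (a b : α → ℝ) (l : List α) : ∀ f : List α → ℝ,
    T a (T b f) l = T b (T a f) l := by
  induction l with
  | nil => intro f; simp [T]
  | cons w l ih =>
    intro f
    rw [T_cons, T_cons]
    simp only [T_cons, T_add, T_mul]
    rw [ih]
    ring

/-- Wick polynomial of a list of vectors. -/
noncomputable def W {N : ℕ} (l : List (E N)) : E N → ℝ :=
  wickRV (stdGaussian N) (l.map fun v => fun x : E N => ⟪x, v⟫)

lemma W_nil {N : ℕ} (x : E N) : W [] x = 1 := by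
  simp [W, wickRV]

lemma W_cons {N : ℕ} (v : E N) (l : List (E N)) (x : E N) :
    W (v :: l) x = ⟪x, v⟫ * W l x - T (fun w => ⟪v, w⟫) (fun m => W m x) l := by
  unfold W
  rw [List.map_cons, wickRV]
  congr 1
  unfold T
  refine Fintype.sum_equiv (finCongr (by simp)) _ _ fun j => ?_
  simp only [List.get_eq_getElem, List.getElem_map, cov, finCongr_apply, Fin.val_cast,
    List.eraseIdx_map]

lemma W_PG {N : ℕ} : ∀ (n : ℕ) (l : List (E N)), l.length = n → PG (W l) := by
  intro n
  induction n using Nat.strong_induction_on with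
  | _ n ih =>
    intro l hl
    cases l with
    | nil =>
      have : W ([] : List (E N)) = fun _ => 1 := funext W_nil
      rw [this]; exact PG.const 1
    | cons v l =>
      have : W (v :: l) = fun x => ⟪x, v⟫ * W l x - T (fun w => ⟪v, w⟫) (fun m => W m x) l :=
        funext (W_cons v l)
      rw [this]
      simp only [List.length_cons] at hl
      refine ((PG.inner v).mul (ih l.length (by omega) l rfl)).sub ?_
      refine PG.sum _ fun j => (PG.const _).mul (ih _ ?_ _ rfl)
      have := List.length_eraseIdx_le l j
      omega

lemma T_PG {N : ℕ} (a : E N → ℝ) (l : List (E N)) : PG (fun x => T a (fun m => W m x) l) :=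
  PG.sum _ fun _ => (PG.const _).mul (W_PG _ _ rfl)

lemma W_lineDeriv {N : ℕ} (u x : E N) : ∀ (n : ℕ) (l : List (E N)), l.length = n →
    HasLineDerivAt ℝ (W l) (T (fun w => ⟪u, w⟫) (fun m => W m x) l) x u := by
  intro n
  induction n using Nat.strong_induction_on with
  | _ n ih =>
    intro l hl
    cases l with
    | nil =>
      have : W ([] : List (E N)) = fun _ => 1 := funext W_nil
      rw [this]
      simpa [T, HasLineDerivAt] using hasDerivAt_const (0 : ℝ) (1 : ℝ)
    | cons v l =>
      have : W (v :: l) = fun x => ⟪x, v⟫ * W l x - T (fun w => ⟪v, w⟫) (fun m => W m x) l :=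
        funext (W_cons v l)
      rw [this]
      simp only [List.length_cons] at hl
      have h1 := ih l.length (by omega) l rfl
      have h2 := inner_lineDeriv v u x
      have h3 : HasLineDerivAt ℝ (fun y => T (fun w => ⟪v, w⟫) (fun m => W m y) l)
          (T (fun w => ⟪v, w⟫) (T (fun w => ⟪u, w⟫) (fun m => W m x)) l) x u := by
        unfold HasLineDerivAt
        refine HasDerivAt.fun_sum fun j _ => HasDerivAt.const_mul _ ?_
        refine ih _ ?_ _ rfl
        have := List.length_eraseIdx_le l j
        omega
      have h4 := (HasDerivAt.mul h2 h1).sub h3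
      unfold HasLineDerivAt
      convert! h4 using 1
      simp only [T_cons, W_cons, T_sub, T_mul, zero_smul, add_zero]
      rw [T_comm (fun w => ⟪v, w⟫)]
      simp only [T]
      ring

lemma key {N : ℕ} (v : E N) (l : List (E N)) {f f' : E N → ℝ} (hf : PG f) (hf' : PG f')
    (hd : ∀ x, HasLineDerivAt ℝ f (f' x) x v) :
    ∫ x, f x * W (v :: l) x ∂(stdGaussian N) = ∫ x, f' x * W l x ∂(stdGaussian N) := by
  have hW : PG (W l) := W_PG _ l rfl
  have hT := T_PG (fun w => ⟪v, w⟫) l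
  have h1 := stein (f := fun x => f x * W l x)
    (f' := fun x => f' x * W l x + f x * T (fun w => ⟪v, w⟫) (fun m => W m x) l) v
    (hf.mul hW) ((hf'.mul hW).add (hf.mul hT)) (fun x => by
      have := HasDerivAt.mul (hd x) (W_lineDeriv v x _ l rfl)
      unfold HasLineDerivAt
      convert! this using 1
      simp)
  rw [integral_add (hf'.mul hW).integrable (hf.mul hT).integrable] at h1
  simp only [W_cons, mul_sub]
  rw [integral_sub (hf.mul ((PG.inner v).mul hW)).integrable (hf.mul hT).integrable]
  have h2 : ∀ x, f x * (⟪x, v⟫ * W l x) = f x * W l x * ⟪x, v⟫ := fun x => by ring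
  simp only [h2]
  rw [h1]
  ring

lemma main {N : ℕ} (m : ℕ) : ∀ (n : ℕ) (v : Fin n → E N) (F : E N → ℝ) (_ : ContDiff ℝ n F)
    (C : ℝ) (_ : 0 ≤ C)
    (_ : ∀ k, k ≤ n → ∀ x, ‖iteratedFDeriv ℝ k F x‖ ≤ C * (1 + ‖x‖) ^ m),
    ∫ x, F x * W (List.ofFn v).reverse x ∂(stdGaussian N)
      = ∫ x, iteratedFDeriv ℝ n F x v ∂(stdGaussian N) := by
  intro n
  induction n with
  | zero =>
    intro v F hF C hC hb
    simp [W_nil]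
  | succ n ih =>
    intro v F hF C hC hb
    have hF' : ContDiff ℝ n (fderiv ℝ F) := hF.fderiv_right (by norm_cast)
    have hdiff : Differentiable ℝ F := hF.differentiable (by simp)
    set u := v (Fin.last n) with hu
    have hG : ContDiff ℝ n (fun x => fderiv ℝ F x u) := hF'.clm_apply contDiff_const
    have hGb : ∀ k, k ≤ n → ∀ x, ‖iteratedFDeriv ℝ k (fun x => fderiv ℝ F x u) x‖
        ≤ (‖u‖ * C) * (1 + ‖x‖) ^ m := by
      intro k hk x
      have h1 := norm_iteratedFDeriv_clm_apply_const (c := u) (n := k) (x := x)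
        hF'.contDiffAt (by exact_mod_cast hk)
      rw [norm_iteratedFDeriv_fderiv] at h1
      refine h1.trans ?_
      rw [mul_assoc]
      gcongr
      exact hb _ (by omega) x
    have hpgF : PG F := ⟨hF.continuous, C, m, hC, fun x => by
      simpa using hb 0 (by omega) x⟩
    have hpgG : PG (fun x => fderiv ℝ F x u) := ⟨hG.continuous, ‖u‖ * C, m, by positivity,
      fun x => by simpa using hGb 0 (by omega) x⟩
    have hl : (List.ofFn v).reverse = u :: (List.ofFn (Fin.init v)).reverse := by
      rw [List.ofFn_succ', List.concat_eq_append, List.reverse_append]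
      rfl
    rw [hl, key u _ hpgF hpgG (fun x => (hdiff x).hasFDerivAt.hasLineDerivAt u),
      ih (Fin.init v) _ hG _ (by positivity) hGb]
    refine integral_congr_ae (Filter.Eventually.of_forall fun x => ?_)
    simp only
    rw [iteratedFDeriv_succ_apply_right, iteratedFDeriv_clm_apply_const_apply hF' le_rfl]

end GaussWick

/-- Gaussian integration by parts for Wick products: for `F : ℝ^N → ℝ` of class `Cⁿ`
with polynomially bounded derivatives, and `X_i(x) = ⟨x, v_i⟩`,
`E[F ⋄_{i=1}^n X_i] = E[DⁿF(v₁,…,vₙ)]` under the standard Gaussian measure `γ_N`. -/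
theorem stmt9 (N : ℕ) (hN : 1 ≤ N) (n : ℕ) (hn : 1 ≤ n)
    (v : Fin n → EuclideanSpace ℝ (Fin N))
    (F : EuclideanSpace ℝ (Fin N) → ℝ) (hF : ContDiff ℝ n F)
    (C p : ℝ) (hC : 0 ≤ C) (hp : 1 ≤ p)
    (hF_bound : ∀ x, |F x| ≤ C * (1 + ‖x‖) ^ p)
    (hDF_bound : ∀ k, 1 ≤ k → k ≤ n → ∀ x, ‖iteratedFDeriv ℝ k F x‖ ≤ C * (1 + ‖x‖) ^ p) :
    ∫ x, F x *
        wickRV (stdGaussian N)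
          ((List.ofFn fun i : Fin n => fun x : EuclideanSpace ℝ (Fin N) => ⟪x, v i⟫).reverse) x
        ∂(stdGaussian N)
      = ∫ x, iteratedFDeriv ℝ n F x v ∂(stdGaussian N) := by
  have h := GaussWick.main ⌈p⌉₊ n v F hF C hC (by
    intro k hk x
    have h1 : (1 : ℝ) ≤ 1 + ‖x‖ := by linarith [norm_nonneg x]
    have h2 : C * (1 + ‖x‖) ^ p ≤ C * (1 + ‖x‖) ^ ⌈p⌉₊ := by
      rw [← Real.rpow_natCast]
      gcongr
      exact Nat.le_ceil p
    refine le_trans ?_ h2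
    rcases Nat.eq_zero_or_pos k with rfl | hk0
    · simpa using hF_bound x
    · exact hDF_bound k hk0 hk x)
  rw [← h]
  unfold GaussWick.W
  rw [List.map_reverse, List.map_ofFn]
  rfl
end

section
/- Let H, μ, Q be as in the context, v ∈ H, and let F : H → ℝ be continuously Fréchet differentiable such that for some C ≥ 0 and p ≥ 1 and all x, y ∈ H: |F(x)| ≤ C(1+‖x‖)^p, ‖dF(x)‖ ≤ C(1+‖x‖)^p, |F(x) − F(y)| ≤ C(1+‖x‖+‖y‖)^p ‖x−y‖, and ‖dF(x) − dF(y)‖ ≤ C(1+‖x‖+‖y‖)^p ‖x−y‖ (operator norms). Then ∫_H F(x) ⟨x, v⟩ dμ(x) = ∫_H dF(x)(Q v) dμ(x). -/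
open MeasureTheory ProbabilityTheory
open scoped RealInnerProductSpace NNReal

lemma integrable_gaussianReal_iff_aux {s : ℝ≥0} (hs : s ≠ 0) {f : ℝ → ℝ}
    (hf : Integrable f (gaussianReal 0 s)) :
    Integrable (fun z => gaussianPDFReal 0 s z * f z) := by
  rw [gaussianReal_of_var_ne_zero _ hs,
    integrable_withDensity_iff_integrable_smul' (measurable_gaussianPDF _ _)
      (ae_of_all _ fun _ => gaussianPDF_lt_top)] at hf
  simpa using hf

lemma stein_one_dim {s : ℝ≥0} (hs : s ≠ 0) {f f' : ℝ → ℝ}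
    (hd : ∀ z, HasDerivAt f (f' z) z)
    (hf : Integrable f (gaussianReal 0 s)) (hf' : Integrable f' (gaussianReal 0 s))
    (hfz : Integrable (fun z => f z * z) (gaussianReal 0 s)) :
    ∫ z, f z * z ∂(gaussianReal 0 s) = s * ∫ z, f' z ∂(gaussianReal 0 s) := by
  have hs' : (s : ℝ) ≠ 0 := by exact_mod_cast hs
  have h1 := integrable_gaussianReal_iff_aux hs hf
  have h2 := integrable_gaussianReal_iff_aux hs hf'
  have h3 := integrable_gaussianReal_iff_aux hs hfz
  rw [integral_gaussianReal_eq_integral_smul hs, integral_gaussianReal_eq_integral_smul hs]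
  have hpd : ∀ z, HasDerivAt (gaussianPDFReal 0 s) (-(z / s) * gaussianPDFReal 0 s z) z := by
    intro z
    rw [gaussianPDFReal_def]
    have h0 : HasDerivAt (fun x : ℝ => -(x - 0) ^ 2 / (2 * (s : ℝ))) (-(z / s)) z := by
      have := ((((hasDerivAt_id z).sub_const 0).pow 2).neg).div_const (2 * (s : ℝ))
      refine this.congr_deriv ?_
      simp
      field_simp
    refine (h0.exp.const_mul _).congr_deriv ?_
    ring
  have key := integral_mul_deriv_eq_deriv_mul_of_integrable (u := f) (u' := f')
    (v := gaussianPDFReal 0 s) (v' := fun z => -(z / s) * gaussianPDFReal 0 s z)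
    (fun z _ => hd z) (fun z _ => hpd z)
    (by
      refine (h3.const_mul (-(s : ℝ)⁻¹)).congr (ae_of_all _ fun z => ?_)
      simp only [Pi.mul_apply]
      field_simp)
    (by
      refine h2.congr (ae_of_all _ fun z => ?_)
      simp only [Pi.mul_apply]
      ring)
    (by
      refine h1.congr (ae_of_all _ fun z => ?_)
      simp only [Pi.mul_apply]
      ring)
  have e1 : ∫ z, gaussianPDFReal 0 s z • (f z * z)
      = -(s : ℝ) * ∫ z, f z * (-(z / s) * gaussianPDFReal 0 s z) := by
    rw [← integral_const_mul]
    congr 1; ext z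
    simp only [smul_eq_mul]
    field_simp
  rw [e1, key]
  simp only [smul_eq_mul, mul_comm (gaussianPDFReal 0 s _)]
  ring

/-- Gaussian integration by parts on a separable Hilbert space (first order):
if `μ` is a centred Gaussian measure on `H` with covariance operator `Q`, and
`F : H → ℝ` is `C¹` with polynomially bounded values and derivative, both locally
Lipschitz with polynomial weights, then `∫ F(x)⟨x,v⟩ dμ = ∫ dF(x)(Qv) dμ`. -/
theorem stmt10 {H : Type*} [NormedAddCommGroup H] [InnerProductSpace ℝ H]
    [CompleteSpace H] [TopologicalSpace.SeparableSpace H]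
    [MeasurableSpace H] [BorelSpace H]
    (μ : Measure H) [IsProbabilityMeasure μ]
    (hgauss : ∀ L : H →L[ℝ] ℝ, ∃ var : ℝ≥0, μ.map L = gaussianReal 0 var)
    (Q : H →L[ℝ] H)
    (hQ : ∀ u w : H, ∫ x, ⟪x, u⟫ * ⟪x, w⟫ ∂μ = ⟪Q u, w⟫)
    (v : H) (F : H → ℝ) (hF : ContDiff ℝ 1 F)
    (C p : ℝ) (hC : 0 ≤ C) (hp : 1 ≤ p)
    (hF_bound : ∀ x, |F x| ≤ C * (1 + ‖x‖) ^ p)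
    (hDF_bound : ∀ x, ‖fderiv ℝ F x‖ ≤ C * (1 + ‖x‖) ^ p)
    (hF_lip : ∀ x y, |F x - F y| ≤ C * (1 + ‖x‖ + ‖y‖) ^ p * ‖x - y‖)
    (hDF_lip : ∀ x y, ‖fderiv ℝ F x - fderiv ℝ F y‖ ≤ C * (1 + ‖x‖ + ‖y‖) ^ p * ‖x - y‖) :
    ∫ x, F x * ⟪x, v⟫ ∂μ = ∫ x, fderiv ℝ F x (Q v) ∂μ := by
  have : SecondCountableTopology H := UniformSpace.secondCountable_of_separable H
  have hG : IsGaussian μ := isGaussian_of_map_eq_gaussianReal fun L => ⟨0, hgauss L⟩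
  -- moments
  have hmom : ∀ r : ℝ, 0 < r → Integrable (fun x : H => (1 + ‖x‖) ^ r) μ := by
    intro r hr
    have h1 : MemLp (fun x : H => 1 + ‖x‖) (ENNReal.ofReal r) μ :=
      (memLp_const (1 : ℝ)).add (IsGaussian.memLp_id μ (ENNReal.ofReal r) (by simp)).norm
    have h2 := h1.integrable_norm_rpow (by simpa using hr) (by simp)
    refine h2.congr (ae_of_all _ fun x => ?_)
    have : 0 ≤ 1 + ‖x‖ := by positivity
    simp only [ENNReal.toReal_ofReal hr.le, Real.norm_of_nonneg this]
  have hFc : Continuous F := hF.continuous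
  have hDFc : Continuous (fderiv ℝ F) := hF.continuous_fderiv (by simp)
  have hpp : 0 < p := by linarith
  have hFi : Integrable F μ := by
    refine ((hmom p hpp).const_mul C).mono' hFc.aestronglyMeasurable (ae_of_all _ fun x => ?_)
    simpa using hF_bound x
  have hFvi : Integrable (fun x => F x * ⟪x, v⟫) μ := by
    refine ((hmom (p + 1) (by linarith)).const_mul (C * ‖v‖)).mono'
      (by fun_prop) (ae_of_all _ fun x => ?_)
    have h0 : 0 < 1 + ‖x‖ := by positivity
    rw [Real.rpow_add_one h0.ne', norm_mul]
    calc ‖F x‖ * ‖⟪x, v⟫‖ ≤ (C * (1 + ‖x‖) ^ p) * ((1 + ‖x‖) * ‖v‖) := by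
          gcongr
          · simpa using hF_bound x
          · refine (norm_inner_le_norm x v).trans ?_
            gcongr
            linarith
      _ = _ := by ring
  have hDFi : Integrable (fun x => fderiv ℝ F x (Q v)) μ := by
    refine ((hmom p hpp).const_mul (C * ‖Q v‖)).mono'
      (by fun_prop) (ae_of_all _ fun x => ?_)
    calc ‖fderiv ℝ F x (Q v)‖ ≤ ‖fderiv ℝ F x‖ * ‖Q v‖ := ContinuousLinearMap.le_opNorm _ _
      _ ≤ (C * (1 + ‖x‖) ^ p) * ‖Q v‖ := by gcongr; exact hDF_bound x
      _ = _ := by ring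
  have hmean : ∀ L : H →L[ℝ] ℝ, ∫ x, L x ∂μ = 0 := by
    intro L
    obtain ⟨s, hs⟩ := hgauss L
    have := integral_map (μ := μ) (φ := L) (f := fun z : ℝ => z) (by fun_prop) (by fun_prop)
    rw [← this, hs, integral_id_gaussianReal]
  have hinnerL2 : ∀ u : H, MemLp (fun x : H => ⟪x, u⟫) 2 μ := by
    intro u
    have := IsGaussian.memLp_dual μ (innerSL ℝ u) 2 (by simp)
    refine this.congr_norm (by fun_prop) (ae_of_all _ fun x => ?_)
    simp [real_inner_comm]
  obtain ⟨s, hs⟩ := hgauss (innerSL ℝ v)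
  have hsv : (s : ℝ) = ⟪Q v, v⟫ := by
    rw [← hQ v v]
    have h1 := integral_map (μ := μ) (φ := innerSL ℝ v) (f := fun z : ℝ => z ^ 2)
      (by fun_prop) (by fun_prop)
    have h2 := variance_id_gaussianReal (μ := 0) (v := s)
    rw [variance_of_integral_eq_zero (by fun_prop) (by simp)] at h2
    rw [← h2]
    simp only [id]
    rw [← hs, h1]
    congr 1; ext x
    simp [real_inner_comm, sq]
  by_cases hs0 : s = 0
  · have hae : ∀ᵐ x ∂μ, ⟪x, v⟫ = 0 := by
      have h0 : ∫ x, ⟪x, v⟫ ^ 2 ∂μ = 0 := by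
        simp only [sq]
        rw [hQ, ← hsv, hs0]; simp
      rw [integral_eq_zero_iff_of_nonneg (fun x => sq_nonneg _) (hinnerL2 v).integrable_sq] at h0
      filter_upwards [h0] with x hx
      simpa using hx
    have hQv : Q v = 0 := by
      rw [← inner_self_eq_zero (𝕜 := ℝ), ← hQ]
      rw [← integral_zero H ℝ (μ := μ)]
      refine integral_congr_ae ?_
      filter_upwards [hae] with x hx
      simp [hx]
    rw [hQv]
    simp only [map_zero, integral_zero]
    rw [← integral_zero H ℝ (μ := μ)]
    refine integral_congr_ae ?_
    filter_upwards [hae] with x hx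
    simp [hx]
  have hs' : (s : ℝ) ≠ 0 := by exact_mod_cast hs0
  set e : H := (s : ℝ)⁻¹ • Q v with he
  let X : H →L[ℝ] ℝ := innerSL ℝ v
  let Y : H →L[ℝ] H := ContinuousLinearMap.id ℝ H - X.smulRight e
  have hX : ∀ x, X x = ⟪x, v⟫ := fun x => by simp [X, real_inner_comm]
  have hY : ∀ x, Y x = x - ⟪x, v⟫ • e := fun x => by simp [Y, hX]
  have hXY : HasGaussianLaw (fun x => (X x, Y x)) μ :=
    (IsGaussian.hasGaussianLaw_id (μ := μ)).map (X.prod Y)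
  have hind : IndepFun X Y μ := by
    refine hXY.indepFun_of_covariance_inner fun a b => ?_
    have hm1 : MemLp (fun x => ⟪a, X x⟫) 2 μ := by
      refine ((hinnerL2 v).const_mul a).congr_norm (by fun_prop) (ae_of_all _ fun x => ?_)
      simp [hX, mul_comm]
    have hm2 : MemLp (fun x => ⟪b, Y x⟫) 2 μ := 
      IsGaussian.memLp_dual μ ((innerSL ℝ b).comp Y) 2 (by simp)
    rw [covariance_eq_sub hm1 hm2]
    have hz : ∫ x, ⟪b, Y x⟫ ∂μ = 0 := hmean ((innerSL ℝ b).comp Y)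
    have hi : ∀ u w, Integrable (fun x : H => ⟪x, u⟫ * ⟪x, w⟫) μ :=
      fun u w => (hinnerL2 u).integrable_mul (hinnerL2 w)
    rw [hz, mul_zero, sub_zero]
    have : ∀ x, ((fun x => ⟪a, X x⟫) * (fun x => ⟪b, Y x⟫)) x
        = a * (⟪x, v⟫ * ⟪x, b⟫) - a * ⟪e, b⟫ * (⟪x, v⟫ * ⟪x, v⟫) := by
      intro x
      simp only [Pi.mul_apply, hY, hX, inner_sub_right, inner_smul_right]
      have ha : ⟪a, ⟪x, v⟫⟫ = a * ⟪x, v⟫ := by simp [mul_comm]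
      rw [ha, ← real_inner_comm b x, ← real_inner_comm b e]
      ring
    simp_rw [this]
    rw [integral_sub ((hi _ _).const_mul _) ((hi _ _).const_mul _), integral_const_mul,
      integral_const_mul, hQ, hQ, ← hsv, he, real_inner_smul_left]
    field_simp
    ring
  have hmap : μ.map (fun x => (X x, Y x)) = (gaussianReal 0 s).prod (μ.map Y) := by
    rw [← hs]
    exact (indepFun_iff_map_prod_eq_prod_map_map (by fun_prop) (by fun_prop)).1 hind
  have : IsProbabilityMeasure (μ.map Y) := Measure.isProbabilityMeasure_map (by fun_prop)
  have hrec : ∀ x, Y x + X x • e = x := fun x => by simp [hX, hY]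
  have hcm : Measurable (fun x => (X x, Y x)) := by fun_prop
  have trans_int : ∀ g : ℝ × H → ℝ, Continuous g → Integrable (fun x => g (X x, Y x)) μ →
      Integrable g ((gaussianReal 0 s).prod (μ.map Y)) := by
    intro g hg hgi
    rw [← hmap]
    exact (integrable_map_measure hg.aestronglyMeasurable hcm.aemeasurable).2 hgi
  have trans_eq : ∀ g : ℝ × H → ℝ, Continuous g → 
      ∫ x, g (X x, Y x) ∂μ = ∫ z, g z ∂((gaussianReal 0 s).prod (μ.map Y)) := by
    intro g hg
    rw [← hmap, integral_map hcm.aemeasurable hg.aestronglyMeasurable]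
  let g0 : ℝ × H → ℝ := fun z => F (z.2 + z.1 • e)
  let g1 : ℝ × H → ℝ := fun z => F (z.2 + z.1 • e) * z.1
  let g2 : ℝ × H → ℝ := fun z => fderiv ℝ F (z.2 + z.1 • e) (Q v)
  have c0 : Continuous g0 := by fun_prop
  have c1 : Continuous g1 := by fun_prop
  have c2 : Continuous g2 := by fun_prop
  have i0 := trans_int g0 c0 (by simpa only [g0, hrec] using hFi)
  have i1 := trans_int g1 c1 (by simp only [g1, hrec]; simpa only [hX] using hFvi)
  have i2 := trans_int g2 c2 (by simpa only [g2, hrec] using hDFi)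
  have t1 := trans_eq g1 c1
  have t2 := trans_eq g2 c2
  simp only [g1, hrec] at t1
  simp only [hX] at t1
  simp only [g2, hrec] at t2
  rw [t1, t2, integral_prod_symm _ i1, integral_prod_symm _ i2]
  refine integral_congr_ae ?_
  filter_upwards [i0.prod_left_ae, i1.prod_left_ae, i2.prod_left_ae] with y j0 j1 j2
  have hd : ∀ z : ℝ, HasDerivAt (fun z : ℝ => F (y + z • e))
      ((s : ℝ)⁻¹ * fderiv ℝ F (y + z • e) (Q v)) z := by
    intro z
    have h1 : HasDerivAt (fun z : ℝ => y + z • e) e z := by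
      simpa using ((hasDerivAt_id z).smul_const e).const_add y
    have h2 := ((hF.differentiable (by simp)) (y + z • e)).hasFDerivAt.comp_hasDerivAt z h1
    refine h2.congr_deriv ?_
    simp [he]
  have := stein_one_dim hs0 hd j0 (j2.const_mul _) j1
  rw [integral_const_mul, ← mul_assoc, mul_inv_cancel₀ hs', one_mul] at this
  exact this
end

section
/- Let H, μ, Q be as in the context, u, v ∈ H, and let F : H → ℝ be twice continuously Fréchet differentiable such that for some C ≥ 0 and p ≥ 1 and all x, y ∈ H and 0 ≤ k ≤ 2: ‖d^k F(x)‖ ≤ C(1+‖x‖)^p and ‖d^k F(x) − d^k F(y)‖ ≤ C(1+‖x‖+‖y‖)^p ‖x−y‖ (d⁰F := F, norms being operator norms of k-linear maps). Then ∫_H F(x) ( ⟨x, u⟩⟨x, v⟩ − ⟨Qu, v⟩ ) dμ(x) = ∫_H d²F(x)(Qu, Qv) dμ(x). -/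
open MeasureTheory ProbabilityTheory
open scoped RealInnerProductSpace NNReal

theorem stein_real {s : ℝ≥0} (hs : s ≠ 0) {f f' : ℝ → ℝ} (hf : ∀ x, HasDerivAt f (f' x) x)
    (h1 : Integrable f (gaussianReal 0 s)) (h2 : Integrable (fun x => f x * x) (gaussianReal 0 s))
    (h3 : Integrable f' (gaussianReal 0 s)) :
    ∫ x, f x * x ∂(gaussianReal 0 s) = s * ∫ x, f' x ∂(gaussianReal 0 s) := by
  have key : ∀ g : ℝ → ℝ, Integrable g (gaussianReal 0 s) →
      Integrable (fun x => g x * gaussianPDFReal 0 s x) := by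
    intro g hg
    rw [gaussianReal_of_var_ne_zero _ hs, integrable_withDensity_iff (measurable_gaussianPDF 0 s)
      (by simp [gaussianPDF_lt_top])] at hg
    simpa using hg
  have hs' : (s : ℝ) ≠ 0 := by exact_mod_cast hs
  have hd : ∀ x, HasDerivAt (gaussianPDFReal 0 s) (-(x / s) * gaussianPDFReal 0 s x) x := by
    intro x
    rw [gaussianPDFReal_def]
    have h := (((((hasDerivAt_id x).sub_const 0).pow 2).neg.div_const (2 * (s:ℝ))).exp).const_mul
      ((√(2 * Real.pi * s))⁻¹)
    refine h.congr_deriv ?_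
    simp only [id, sub_zero, Nat.cast_ofNat, Pi.neg_apply, Pi.pow_apply]
    field_simp
    simp
  have ibp := integral_mul_deriv_eq_deriv_mul_of_integrable (u := f) (u' := f')
    (v := gaussianPDFReal 0 s) (v' := fun x => -(x / s) * gaussianPDFReal 0 s x)
    (fun x _ => hf x) (fun x _ => hd x) ?_ (key _ h3) (key _ h1)
  · rw [integral_gaussianReal_eq_integral_smul hs, integral_gaussianReal_eq_integral_smul hs]
    simp only [smul_eq_mul]
    have e1 : ∫ x, gaussianPDFReal 0 s x * f' x = ∫ x, f' x * gaussianPDFReal 0 s x :=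
      integral_congr_ae (.of_forall fun x => mul_comm _ _)
    rw [e1, ← neg_eq_iff_eq_neg.2 ibp, ← integral_neg, ← integral_const_mul]
    refine integral_congr_ae (.of_forall fun x => ?_)
    simp only
    field_simp
  · refine ((key _ h2).const_mul (-(1 / (s:ℝ)))).congr (.of_forall fun x => ?_)
    simp only [Pi.mul_apply]
    field_simp

section
variable {H : Type*} [NormedAddCommGroup H] [InnerProductSpace ℝ H]
    [CompleteSpace H] [TopologicalSpace.SeparableSpace H]
    [MeasurableSpace H] [BorelSpace H]
    (μ : Measure H) [IsProbabilityMeasure μ]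

theorem stein_isGaussian
    (hgauss : ∀ L : H →L[ℝ] ℝ, ∃ var : ℝ≥0, μ.map L = gaussianReal 0 var) : IsGaussian μ :=
  isGaussian_of_map_eq_gaussianReal fun L => ⟨0, hgauss L⟩

theorem stein_first
    (hgauss : ∀ L : H →L[ℝ] ℝ, ∃ var : ℝ≥0, μ.map L = gaussianReal 0 var)
    (Q : H →L[ℝ] H)
    (hQ : ∀ u w : H, ∫ x, ⟪x, u⟫ * ⟪x, w⟫ ∂μ = ⟪Q u, w⟫)
    (u : H) (G : H → ℝ) (G' : H → H →L[ℝ] ℝ) (hG : ∀ x, HasFDerivAt G (G' x) x)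
    (hGc : Continuous fun x => G' x (Q u))
    (i1 : Integrable G μ) (i2 : Integrable (fun x => G x * ⟪x, u⟫) μ)
    (i3 : Integrable (fun x => G' x (Q u)) μ) :
    ∫ x, G x * ⟪x, u⟫ ∂μ = ∫ x, G' x (Q u) ∂μ := by
  haveI : SecondCountableTopology H := UniformSpace.secondCountable_of_separable H
  haveI := stein_isGaussian μ hgauss
  have hGcont : Continuous G := continuous_iff_continuousAt.2 fun x => (hG x).continuousAt
  have hmem : ∀ w : H, MemLp (fun x => ⟪x, w⟫) 2 μ := fun w =>
    (IsGaussian.memLp_two_id (μ := μ)).inner_const w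
  have hmean : ∀ w : H, ∫ x, ⟪x, w⟫ ∂μ = 0 := by
    intro w
    obtain ⟨a, ha⟩ := hgauss (innerSL ℝ w)
    have h : ∫ y, y ∂(μ.map (innerSL ℝ w)) = ∫ x, innerSL ℝ w x ∂μ :=
      integral_map (by fun_prop) (by fun_prop)
    rw [ha, integral_id_gaussianReal] at h
    simpa [real_inner_comm] using h.symm
  obtain ⟨s, hs⟩ := hgauss (innerSL ℝ u)
  have hZ : (fun x => ⟪x, u⟫) = ⇑(innerSL ℝ u) := by ext x; simp [real_inner_comm]
  have hsQ : (s : ℝ) = ⟪Q u, u⟫ := by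
    have h : Var[fun y => y; μ.map (innerSL ℝ u)] = Var[innerSL ℝ u; μ] :=
      variance_map (by fun_prop) (by fun_prop)
    rw [hs, variance_fun_id_gaussianReal, ← hZ, variance_of_integral_eq_zero (by fun_prop) (hmean u)] at h
    rw [h, ← hQ]
    simp [pow_two]
  by_cases h0 : s = 0
  · subst h0
    have hz : ∀ᵐ x ∂μ, ⟪x, u⟫ = 0 := by
      have hi : Integrable (fun x => ⟪x, u⟫ * ⟪x, u⟫) μ := (hmem u).integrable_mul (hmem u)
      have h := (integral_eq_zero_iff_of_nonneg (fun x => mul_self_nonneg _) hi).1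
        (by rw [hQ, ← hsQ]; simp)
      filter_upwards [h] with x hx
      simpa using hx
    have hQu : Q u = 0 := by
      refine ext_inner_right ℝ fun w => ?_
      rw [← hQ, inner_zero_left]
      refine integral_eq_zero_of_ae ?_
      filter_upwards [hz] with x hx
      simp [hx]
    rw [hQu]
    simp only [map_zero, integral_zero]
    refine integral_eq_zero_of_ae ?_
    filter_upwards [hz] with x hx
    simp [hx]
  have hs0 : (s : ℝ) ≠ 0 := by exact_mod_cast h0
  set h : H := (s : ℝ)⁻¹ • Q u with hh
  have hhQ : Q u = (s : ℝ) • h := by rw [hh, smul_inv_smul₀ hs0]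
  let Z : H →L[ℝ] ℝ := innerSL ℝ u
  let Y : H →L[ℝ] H := ContinuousLinearMap.id ℝ H - Z.smulRight h
  have hYZ : ∀ x, Y x + Z x • h = x := by intro x; simp [Y]
  have hT : HasGaussianLaw (fun x => (Y x, Z x)) μ :=
    (IsGaussian.hasGaussianLaw_id (μ := μ)).map (Y.prod Z)
  have hind : IndepFun Y Z μ := by
    refine hT.indepFun_of_covariance_inner fun w c => ?_
    have e1 : (fun x => ⟪w, Y x⟫) = fun x => ⟪x, w - ⟪h, w⟫ • u⟫ := by
      ext x
      simp [Y, Z, inner_sub_right, inner_smul_right, real_inner_comm]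
      ring
    have e2 : (fun x => ⟪c, Z x⟫) = fun x => ⟪x, c • u⟫ := by
      ext x
      simp [Z, inner_smul_right, real_inner_comm]
      try ring
    rw [e1, e2, covariance_eq_sub (hmem _) (hmem _), hmean, hmean]
    simp only [Pi.mul_apply]
    rw [hQ]
    simp only [map_sub, map_smul, inner_sub_left, inner_smul_left, inner_smul_right]
    have e3 : ⟪Q w, u⟫ = ⟪Q u, w⟫ := by
      rw [← hQ, ← hQ]; simp only [mul_comm]
    rw [e3, ← hsQ, hhQ]
    simp [inner_smul_left]
    ring_nf
    simp
  have hmap : μ.map (fun x => (Y x, Z x)) = (μ.map Y).prod (gaussianReal 0 s) := by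
    rw [hind.map_prod_eq_prod_map_map (by fun_prop) (by fun_prop), ← hs]
  haveI : IsProbabilityMeasure (μ.map Y) := Measure.isProbabilityMeasure_map (by fun_prop)
  have trans : ∀ g : H × ℝ → ℝ, Continuous g → Integrable (fun x => g (Y x, Z x)) μ →
      Integrable g ((μ.map Y).prod (gaussianReal 0 s)) ∧
      ∫ x, g (Y x, Z x) ∂μ = ∫ y, ∫ z, g (y, z) ∂(gaussianReal 0 s) ∂(μ.map Y) := by
    intro g hg hi
    have hI : Integrable g ((μ.map Y).prod (gaussianReal 0 s)) := by
      rw [← hmap]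
      exact (integrable_map_measure hg.aestronglyMeasurable (by fun_prop)).2 hi
    refine ⟨hI, ?_⟩
    rw [← integral_prod _ hI, ← hmap, integral_map (by fun_prop) hg.aestronglyMeasurable]
  have t1 := trans (fun q => G (q.1 + q.2 • h)) (by fun_prop) (by simpa only [hYZ] using i1)
  have t2 := trans (fun q => G (q.1 + q.2 • h) * q.2) (by fun_prop)
    (by simp only [hYZ]; simpa only [Z, ← hZ] using i2)
  have t3 := trans (fun q => G' (q.1 + q.2 • h) (Q u))
    (hGc.comp (by fun_prop : Continuous fun q : H × ℝ => q.1 + q.2 • h))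
    (by simpa only [hYZ] using i3)
  have r2 := t2.2
  have r3 := t3.2
  simp only [hYZ] at r2 r3
  rw [r3]
  have : ∫ x, G x * ⟪x, u⟫ ∂μ = ∫ x, G x * Z x ∂μ := by simp only [Z, ← hZ]
  rw [this, r2]
  refine integral_congr_ae ?_
  filter_upwards [t1.1.prod_right_ae, t2.1.prod_right_ae, t3.1.prod_right_ae] with y y1 y2 y3
  have y4 : Integrable (fun z => G' (y + z • h) h) (gaussianReal 0 s) := by
    convert y3.const_mul ((s:ℝ)⁻¹) using 1
    ext z
    rw [hhQ]
    simp [hs0]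
  rw [stein_real h0 (f' := fun z => G' (y + z • h) h) ?_ y1 y2 y4, ← integral_const_mul]
  · simp only [hhQ, map_smul, smul_eq_mul]
  · intro z
    have hl : HasDerivAt (fun z : ℝ => y + z • h) h z := by
      simpa using ((hasDerivAt_id z).smul_const h).const_add y
    exact (hG _).comp_hasDerivAt z hl

theorem stein_int [IsGaussian μ] (C q : ℝ) (hq : 0 < q) (G : H → ℝ) (hG : Continuous G)
    (hb : ∀ x, ‖G x‖ ≤ C * (1 + ‖x‖) ^ q) : Integrable G μ := by
  haveI : SecondCountableTopology H := UniformSpace.secondCountable_of_separable H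
  have h1 : MemLp (fun x : H => 1 + ‖x‖) (ENNReal.ofReal q) μ := by
    have hn : MemLp (fun x : H => ‖x‖) (ENNReal.ofReal q) μ :=
      (IsGaussian.memLp_id μ (ENNReal.ofReal q) ENNReal.ofReal_ne_top).norm
    exact (memLp_const (1 : ℝ)).add hn
  have h2 := h1.integrable_norm_rpow (by simpa using hq) (by simp)
  rw [ENNReal.toReal_ofReal hq.le] at h2
  refine (h2.const_mul C).mono' hG.aestronglyMeasurable (.of_forall fun x => ?_)
  refine (hb x).trans_eq ?_
  rw [Real.norm_of_nonneg (by positivity)]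

end

/-- Gaussian integration by parts on a separable Hilbert space (second order):
if `μ` is a centred Gaussian measure on `H` with covariance operator `Q`, and
`F : H → ℝ` is `C²` with `‖d^k F(x)‖ ≤ C(1+‖x‖)^p` and
`‖d^k F(x) − d^k F(y)‖ ≤ C(1+‖x‖+‖y‖)^p ‖x−y‖` for `0 ≤ k ≤ 2` (with `d⁰F = F`),
then `∫ F(x)(⟨x,u⟩⟨x,v⟩ − ⟨Qu,v⟩) dμ = ∫ d²F(x)(Qu,Qv) dμ`. -/
theorem stmt11 {H : Type*} [NormedAddCommGroup H] [InnerProductSpace ℝ H]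
    [CompleteSpace H] [TopologicalSpace.SeparableSpace H]
    [MeasurableSpace H] [BorelSpace H]
    (μ : Measure H) [IsProbabilityMeasure μ]
    (hgauss : ∀ L : H →L[ℝ] ℝ, ∃ var : ℝ≥0, μ.map L = gaussianReal 0 var)
    (Q : H →L[ℝ] H)
    (hQ : ∀ u w : H, ∫ x, ⟪x, u⟫ * ⟪x, w⟫ ∂μ = ⟪Q u, w⟫)
    (u v : H) (F : H → ℝ) (hF : ContDiff ℝ 2 F)
    (C p : ℝ) (hC : 0 ≤ C) (hp : 1 ≤ p)
    (hDF_bound : ∀ k ≤ 2, ∀ x, ‖iteratedFDeriv ℝ k F x‖ ≤ C * (1 + ‖x‖) ^ p)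
    (hDF_lip : ∀ k ≤ 2, ∀ x y, ‖iteratedFDeriv ℝ k F x - iteratedFDeriv ℝ k F y‖
      ≤ C * (1 + ‖x‖ + ‖y‖) ^ p * ‖x - y‖) :
    ∫ x, F x * (⟪x, u⟫ * ⟪x, v⟫ - ⟪Q u, v⟫) ∂μ
      = ∫ x, iteratedFDeriv ℝ 2 F x ![Q u, Q v] ∂μ := by
  haveI := stein_isGaussian μ hgauss
  have hp0 : 0 < p := by linarith
  have hF0 : Continuous F := hF.continuous
  have hF1 : ContDiff ℝ 1 (fderiv ℝ F) := hF.fderiv_right (by norm_num)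
  have hF1c : Continuous (fderiv ℝ F) := hF1.continuous
  have hF2c : Continuous (fderiv ℝ (fderiv ℝ F)) := (hF1.fderiv_right (m := 0) (by norm_num)).continuous
  have hd1 : ∀ x, HasFDerivAt F (fderiv ℝ F x) x := fun x =>
    (hF.differentiable (by norm_num) x).hasFDerivAt
  have hd2 : ∀ x, HasFDerivAt (fderiv ℝ F) (fderiv ℝ (fderiv ℝ F) x) x := fun x =>
    (hF1.differentiable (by norm_num) x).hasFDerivAt
  have b0 : ∀ x, ‖F x‖ ≤ C * (1 + ‖x‖) ^ p := fun x => by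
    simpa using hDF_bound 0 (by norm_num) x
  have b1 : ∀ a x, ‖fderiv ℝ F x a‖ ≤ (C * ‖a‖) * (1 + ‖x‖) ^ p := fun a x => by
    have h := hDF_bound 1 (by norm_num) x
    rw [norm_iteratedFDeriv_one] at h
    calc _ ≤ ‖fderiv ℝ F x‖ * ‖a‖ := ContinuousLinearMap.le_opNorm _ _
      _ ≤ (C * (1 + ‖x‖) ^ p) * ‖a‖ := by gcongr
      _ = _ := by ring
  have b2 : ∀ a b x, ‖fderiv ℝ (fderiv ℝ F) x a b‖ ≤ (C * ‖a‖ * ‖b‖) * (1 + ‖x‖) ^ p :=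
      fun a b x => by
    have h := hDF_bound 2 (by norm_num) x
    have e : fderiv ℝ (fderiv ℝ F) x a b = iteratedFDeriv ℝ 2 F x ![a, b] := by
      rw [iteratedFDeriv_two_apply]; simp
    rw [e]
    calc _ ≤ ‖iteratedFDeriv ℝ 2 F x‖ * ∏ i, ‖![a, b] i‖ := ContinuousMultilinearMap.le_opNorm _ _
      _ ≤ (C * (1 + ‖x‖) ^ p) * ∏ i, ‖![a, b] i‖ := by gcongr
      _ = _ := by simp [Fin.prod_univ_two]; ring
  have bi : ∀ (a x : H), ‖⟪x, a⟫‖ ≤ ‖a‖ * (1 + ‖x‖) := fun a x => by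
    refine (norm_inner_le_norm x a).trans ?_
    nlinarith [norm_nonneg a, norm_nonneg x]
  have pw : ∀ (x : H) (q : ℝ), (1 + ‖x‖) ^ (q + 1) = (1 + ‖x‖) ^ q * (1 + ‖x‖) := fun x q => by
    rw [Real.rpow_add (by positivity), Real.rpow_one]
  -- multiplication by a linear functional raises the growth exponent by one
  have bm : ∀ (G : H → ℝ) (D q : ℝ) (a : H), 0 ≤ D → (∀ x, ‖G x‖ ≤ D * (1 + ‖x‖) ^ q) →
      ∀ x, ‖G x * ⟪x, a⟫‖ ≤ (D * ‖a‖) * (1 + ‖x‖) ^ (q + 1) := fun G D q a hD hb x => by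
    rw [norm_mul, pw]
    calc _ ≤ (D * (1 + ‖x‖) ^ q) * (‖a‖ * (1 + ‖x‖)) := by
          gcongr
          · exact hb x
          · exact bi a x
      _ = _ := by ring
  have c1 : ∀ a, Continuous fun x => fderiv ℝ F x a := fun a => by fun_prop
  have iF : Integrable F μ := stein_int μ C p hp0 F hF0 b0
  have iFi : ∀ a, Integrable (fun x => F x * ⟪x, a⟫) μ := fun a =>
    stein_int μ _ (p + 1) (by linarith) _ (by fun_prop) (bm F C p a hC b0)
  have iFii : ∀ a b, Integrable (fun x => F x * ⟪x, a⟫ * ⟪x, b⟫) μ := fun a b =>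
    stein_int μ _ (p + 1 + 1) (by linarith) _ (by fun_prop)
      (bm _ _ (p + 1) b (by positivity) (bm F C p a hC b0))
  have iD : ∀ a, Integrable (fun x => fderiv ℝ F x a) μ := fun a =>
    stein_int μ _ p hp0 _ (c1 a) (b1 a)
  have iDi : ∀ a b, Integrable (fun x => fderiv ℝ F x a * ⟪x, b⟫) μ := fun a b =>
    stein_int μ _ (p + 1) (by linarith) _ ((c1 a).mul (by fun_prop))
      (bm _ _ p b (by positivity) (b1 a))
  have iDD : ∀ a b, Integrable (fun x => fderiv ℝ (fderiv ℝ F) x a b) μ := fun a b =>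
    stein_int μ _ p hp0 _ (by fun_prop) (b2 a b)
  -- first application, to `F x * ⟪x, u⟫` in the direction `v`
  have s1 := stein_first μ hgauss Q hQ v (fun x => F x * ⟪x, u⟫)
    (fun x => F x • innerSL ℝ u + ⟪x, u⟫ • fderiv ℝ F x)
    (fun x => by
      have hi : HasFDerivAt (fun x : H => ⟪x, u⟫) (innerSL ℝ u) x := by
        have h := (innerSL ℝ u).hasFDerivAt (x := x)
        refine h.congr_of_eventuallyEq (.of_forall fun y => ?_)
        simp [real_inner_comm]
      exact (hd1 x).mul hi)
    (by
      simp only [ContinuousLinearMap.add_apply, ContinuousLinearMap.smul_apply, smul_eq_mul]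
      have := c1 (Q v)
      fun_prop)
    (iFi u) (iFii u v)
    (by
      simp only [ContinuousLinearMap.add_apply, ContinuousLinearMap.smul_apply, smul_eq_mul]
      refine (iF.mul_const _).add ?_
      simpa only [mul_comm] using iDi (Q v) u)
  -- second application, to `dF(x)(Qv)` in the direction `u`
  have s2 := stein_first μ hgauss Q hQ u (fun x => fderiv ℝ F x (Q v))
    (fun x => (fderiv ℝ (fderiv ℝ F) x).flip (Q v))
    (fun x => by simpa using (hd2 x).clm_apply (hasFDerivAt_const (Q v) x))
    (by simp only [ContinuousLinearMap.flip_apply]; fun_prop)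
    (iD (Q v)) (iDi (Q v) u)
    (by simpa only [ContinuousLinearMap.flip_apply] using iDD (Q u) (Q v))
  have sym : ⟪u, Q v⟫ = ⟪Q u, v⟫ := by
    rw [real_inner_comm, ← hQ, ← hQ]; simp only [mul_comm]
  simp only [ContinuousLinearMap.add_apply, ContinuousLinearMap.smul_apply, smul_eq_mul,
    innerSL_apply_apply, sym] at s1
  rw [integral_add (iF.mul_const _) (by simpa only [mul_comm] using iDi (Q v) u)] at s1
  simp only [ContinuousLinearMap.flip_apply] at s2
  have e1 : ∫ x, ⟪x, u⟫ * fderiv ℝ F x (Q v) ∂μ = ∫ x, fderiv ℝ F x (Q v) * ⟪x, u⟫ ∂μ := by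
    simp only [mul_comm]
  have e2 : ∫ x, iteratedFDeriv ℝ 2 F x ![Q u, Q v] ∂μ
      = ∫ x, fderiv ℝ (fderiv ℝ F) x (Q u) (Q v) ∂μ := by
    simp [iteratedFDeriv_two_apply]
  have e3 : ∫ x, F x * (⟪x, u⟫ * ⟪x, v⟫ - ⟪Q u, v⟫) ∂μ
      = ∫ x, F x * ⟪x, u⟫ * ⟪x, v⟫ ∂μ - ∫ x, F x * ⟪Q u, v⟫ ∂μ := by
    rw [← integral_sub (iFii u v) (iF.mul_const _)]
    simp only [mul_sub, mul_assoc]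
  rw [e3, e2, ← s2, ← e1, s1]
  ring
end

section
/- Let H, μ, Q be as in the context, u, v, w ∈ H, and let F : H → ℝ be three times continuously Fréchet differentiable such that for some C ≥ 0 and p ≥ 1 and all x, y ∈ H and 0 ≤ k ≤ 3: ‖d^k F(x)‖ ≤ C(1+‖x‖)^p and ‖d^k F(x) − d^k F(y)‖ ≤ C(1+‖x‖+‖y‖)^p ‖x−y‖ (d⁰F := F, norms being operator norms of k-linear maps). Then ∫_H F(x) ( ⟨x,u⟩⟨x,v⟩⟨x,w⟩ − ⟨Qu,v⟩⟨x,w⟩ − ⟨Qu,w⟩⟨x,v⟩ − ⟨Qv,w⟩⟨x,u⟩ ) dμ(x) = ∫_H d³F(x)(Qu, Qv, Qw) dμ(x). -/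
open MeasureTheory ProbabilityTheory
open scoped RealInnerProductSpace NNReal

namespace GaussIBP

/-- Continuous with polynomial growth. -/
def PG {H E : Type*} [NormedAddCommGroup H] [NormedAddCommGroup E] (f : H → E) : Prop :=
  Continuous f ∧ ∃ (C : ℝ) (n : ℕ), 0 ≤ C ∧ ∀ x, ‖f x‖ ≤ C * (1 + ‖x‖) ^ n

section PGlemmas
variable {H E E' : Type*} [NormedAddCommGroup H] [NormedAddCommGroup E] [NormedAddCommGroup E']

lemma PG.add {f g : H → E} (hf : PG f) (hg : PG g) : PG (fun x => f x + g x) := by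
  obtain ⟨cf, C, n, hC, hf⟩ := hf
  obtain ⟨cg, D, m, hD, hg⟩ := hg
  refine ⟨cf.add cg, C + D, n + m, by positivity, fun x => ?_⟩
  have h1 : (1:ℝ) ≤ 1 + ‖x‖ := by linarith [norm_nonneg x]
  calc ‖f x + g x‖ ≤ ‖f x‖ + ‖g x‖ := norm_add_le _ _
    _ ≤ C * (1 + ‖x‖) ^ n + D * (1 + ‖x‖) ^ m := add_le_add (hf x) (hg x)
    _ ≤ C * (1 + ‖x‖) ^ (n + m) + D * (1 + ‖x‖) ^ (n + m) := by
        gcongr <;> first | exact h1 | omega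
    _ = _ := by ring

lemma PG.smul [NormedSpace ℝ E] {f : H → ℝ} {g : H → E} (hf : PG f) (hg : PG g) :
    PG (fun x => f x • g x) := by
  obtain ⟨cf, C, n, hC, hf⟩ := hf
  obtain ⟨cg, D, m, hD, hg⟩ := hg
  refine ⟨cf.smul cg, C * D, n + m, by positivity, fun x => ?_⟩
  calc ‖f x • g x‖ = ‖f x‖ * ‖g x‖ := norm_smul _ _
    _ ≤ (C * (1 + ‖x‖) ^ n) * (D * (1 + ‖x‖) ^ m) :=
        mul_le_mul (hf x) (hg x) (norm_nonneg _) (by positivity)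
    _ = _ := by ring

lemma PG.const (c : E) : PG (fun _ : H => c) :=
  ⟨continuous_const, ‖c‖, 0, norm_nonneg _, fun x => by simp⟩

lemma PG.clm [NormedSpace ℝ E] [NormedSpace ℝ E'] (L : E →L[ℝ] E') {f : H → E} (hf : PG f) :
    PG (fun x => L (f x)) := by
  obtain ⟨cf, C, n, hC, hf⟩ := hf
  refine ⟨L.continuous.comp cf, ‖L‖ * C, n, by positivity, fun x => ?_⟩
  calc ‖L (f x)‖ ≤ ‖L‖ * ‖f x‖ := L.le_opNorm _
    _ ≤ ‖L‖ * (C * (1 + ‖x‖) ^ n) := by gcongr; exact hf x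
    _ = _ := by ring

lemma PG.id : PG (fun x : H => x) :=
  ⟨continuous_id, 1, 1, zero_le_one, fun x => by simp⟩

end PGlemmas

section Meas
variable {H : Type*} [NormedAddCommGroup H] [InnerProductSpace ℝ H]
    [CompleteSpace H] [SecondCountableTopology H]
    [MeasurableSpace H] [BorelSpace H]
    {μ : Measure H} [IsGaussian μ]

lemma integrable_pow (n : ℕ) : Integrable (fun x : H => (1 + ‖x‖) ^ n) μ := by
  have h : MemLp (fun x : H => 1 + ‖x‖) n μ :=
    (memLp_const (1:ℝ)).add (IsGaussian.memLp_id μ n (by simp)).norm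
  have := h.integrable_norm_pow'
  refine this.congr (Filter.Eventually.of_forall fun x => ?_)
  have : (0:ℝ) ≤ 1 + ‖x‖ := by positivity
  simp [abs_of_nonneg this]

lemma PG.integrable {E : Type*} [NormedAddCommGroup E] {f : H → E} (hf : PG f) :
    Integrable f μ := by
  obtain ⟨cf, C, n, hC, hf⟩ := hf
  refine ((integrable_pow (μ := μ) n).const_mul C).mono' cf.aestronglyMeasurable
    (Filter.Eventually.of_forall hf)

lemma ibp (hμ : ∀ L : StrongDual ℝ H, μ[L] = 0) (Q : H →L[ℝ] H)
    (hQ : ∀ u' w' : H, ∫ x, ⟪x, u'⟫ * ⟪x, w'⟫ ∂μ = ⟪Q u', w'⟫)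
    {G : H → ℝ} {G' : H → H →L[ℝ] ℝ} (hG : PG G) (hG' : PG G')
    (hd : ∀ x, HasFDerivAt G (G' x) x) (u : H) :
    ∫ x, G x * ⟪x, u⟫ ∂μ = ∫ x, G' x (Q u) ∂μ := by
  obtain ⟨cG, C, n, hC, bG⟩ := hG
  obtain ⟨cG', C', n', hC', bG'⟩ := hG'
  set N := n + n' + 2 with hN
  let Φ : ℝ → H × H → ℝ := fun t z =>
    G (Real.cos t • z.1 + Real.sin t • z.2) * ⟪-Real.sin t • z.1 + Real.cos t • z.2, u⟫
  let Φ' : ℝ → H × H → ℝ := fun t z =>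
    G' (Real.cos t • z.1 + Real.sin t • z.2) (-Real.sin t • z.1 + Real.cos t • z.2) *
      ⟪-Real.sin t • z.1 + Real.cos t • z.2, u⟫ +
    G (Real.cos t • z.1 + Real.sin t • z.2) * ⟪-Real.cos t • z.1 + -Real.sin t • z.2, u⟫
  let B : H × H → ℝ := fun z => (1 + ‖z.1‖) ^ N * (1 + ‖z.2‖) ^ N
  have hBint : Integrable B (μ.prod μ) := (integrable_pow N).mul_prod (integrable_pow N)
  have comb : ∀ (a b : ℝ) (z : H × H), |a| ≤ 1 → |b| ≤ 1 →
      ‖a • z.1 + b • z.2‖ ≤ ‖z.1‖ + ‖z.2‖ := by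
    intro a b z ha hb
    calc ‖a • z.1 + b • z.2‖ ≤ ‖a • z.1‖ + ‖b • z.2‖ := norm_add_le _ _
      _ = |a| * ‖z.1‖ + |b| * ‖z.2‖ := by simp [norm_smul]
      _ ≤ 1 * ‖z.1‖ + 1 * ‖z.2‖ := by gcongr
      _ = _ := by ring
  have hS : ∀ t, |-Real.sin t| ≤ 1 := fun t => by rw [abs_neg]; exact Real.abs_sin_le_one t
  have hCs : ∀ t, |-Real.cos t| ≤ 1 := fun t => by rw [abs_neg]; exact Real.abs_cos_le_one t
  -- elementary bounds
  have hP1 : ∀ z : H × H, 1 ≤ (1 + ‖z.1‖) * (1 + ‖z.2‖) := fun z => by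
    nlinarith [norm_nonneg z.1, norm_nonneg z.2, mul_nonneg (norm_nonneg z.1) (norm_nonneg z.2)]
  have hP2 : ∀ z : H × H, 1 + (‖z.1‖ + ‖z.2‖) ≤ (1 + ‖z.1‖) * (1 + ‖z.2‖) := fun z => by
    nlinarith [mul_nonneg (norm_nonneg z.1) (norm_nonneg z.2)]
  have bcomb : ∀ (a b : ℝ) (z : H × H), |a| ≤ 1 → |b| ≤ 1 →
      1 + ‖a • z.1 + b • z.2‖ ≤ (1 + ‖z.1‖) * (1 + ‖z.2‖) := fun a b z ha hb => by
    linarith [comb a b z ha hb, hP2 z]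
  have bin : ∀ (a b : ℝ) (z : H × H), |a| ≤ 1 → |b| ≤ 1 →
      ‖⟪a • z.1 + b • z.2, u⟫‖ ≤ ((1 + ‖z.1‖) * (1 + ‖z.2‖)) * ‖u‖ := fun a b z ha hb => by
    refine (norm_inner_le_norm _ _).trans ?_
    gcongr
    linarith [bcomb a b z ha hb]
  have bG2 : ∀ (t : ℝ) (z : H × H) , ‖G (Real.cos t • z.1 + Real.sin t • z.2)‖
      ≤ C * ((1 + ‖z.1‖) * (1 + ‖z.2‖)) ^ n := fun t z => by
    refine (bG _).trans ?_
    gcongr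
    exact bcomb _ _ z (Real.abs_cos_le_one t) (Real.abs_sin_le_one t)
  have bG'2 : ∀ (t : ℝ) (z : H × H) , ‖G' (Real.cos t • z.1 + Real.sin t • z.2)‖
      ≤ C' * ((1 + ‖z.1‖) * (1 + ‖z.2‖)) ^ n' := fun t z => by
    refine (bG' _).trans ?_
    gcongr
    exact bcomb _ _ z (Real.abs_cos_le_one t) (Real.abs_sin_le_one t)
  have bGin : ∀ (t a b : ℝ) (z : H × H), |a| ≤ 1 → |b| ≤ 1 →
      ‖G (Real.cos t • z.1 + Real.sin t • z.2) * ⟪a • z.1 + b • z.2, u⟫‖ ≤ C * ‖u‖ * B z := by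
    intro t a b z ha hb
    have h1 := hP1 z
    set P := (1 + ‖z.1‖) * (1 + ‖z.2‖) with hP
    calc _ = ‖G (Real.cos t • z.1 + Real.sin t • z.2)‖ * ‖⟪a • z.1 + b • z.2, u⟫‖ := norm_mul _ _
      _ ≤ (C * P ^ n) * (P * ‖u‖) :=
        mul_le_mul (bG2 t z) (bin a b z ha hb) (norm_nonneg _) (by positivity)
      _ = C * ‖u‖ * P ^ (n + 1) := by ring
      _ ≤ C * ‖u‖ * P ^ N := by gcongr <;> first | exact h1 | omega
      _ = _ := by rw [hP, mul_pow]
  have bG'in : ∀ (t a b : ℝ) (z : H × H), |a| ≤ 1 → |b| ≤ 1 →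
      ‖G' (Real.cos t • z.1 + Real.sin t • z.2) (a • z.1 + b • z.2)
        * ⟪a • z.1 + b • z.2, u⟫‖ ≤ C' * ‖u‖ * B z := by
    intro t a b z ha hb
    have h1 := hP1 z
    have h2 := bcomb a b z ha hb
    have h3 := bG'2 t z
    have h4 := bin a b z ha hb
    set P := (1 + ‖z.1‖) * (1 + ‖z.2‖) with hP
    have h5 : ‖G' (Real.cos t • z.1 + Real.sin t • z.2) (a • z.1 + b • z.2)‖ ≤ C' * P ^ n' * P := by
      refine (ContinuousLinearMap.le_opNorm _ _).trans ?_
      exact mul_le_mul h3 (by linarith) (norm_nonneg _) (by positivity)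
    rw [norm_mul]
    calc _ ≤ (C' * P ^ n' * P) * (P * ‖u‖) := mul_le_mul h5 h4 (norm_nonneg _) (by positivity)
      _ = C' * ‖u‖ * P ^ (n' + 2) := by ring
      _ ≤ C' * ‖u‖ * P ^ N := by gcongr <;> first | exact h1 | omega
      _ = _ := by rw [hP, mul_pow]
  have cΦ : ∀ t, Continuous (Φ t) := fun t => by fun_prop
  have cΦ' : ∀ t, Continuous (Φ' t) := fun t => by fun_prop
  have hder := (hasDerivAt_integral_of_dominated_loc_of_deriv_le (μ := μ.prod μ) (F := Φ) (F' := Φ')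
    (x₀ := 0) (s := Set.univ) (bound := fun z => C' * ‖u‖ * B z + C * ‖u‖ * B z)
    Filter.univ_mem
    (Filter.Eventually.of_forall fun t => (cΦ t).aestronglyMeasurable)
    ((hBint.const_mul (C * ‖u‖)).mono' (cΦ 0).aestronglyMeasurable
      (Filter.Eventually.of_forall fun z => bGin 0 _ _ z (hS 0) (Real.abs_cos_le_one 0)))
    (cΦ' 0).aestronglyMeasurable
    (Filter.Eventually.of_forall fun z t _ => (norm_add_le _ _).trans (add_le_add
      (bG'in t _ _ z (hS t) (Real.abs_cos_le_one t)) (bGin t _ _ z (hCs t) (hS t))))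
    ((hBint.const_mul _).add (hBint.const_mul _))
    (Filter.Eventually.of_forall fun z t _ => by
      have e1 : HasDerivAt (fun t => Real.cos t • z.1 + Real.sin t • z.2)
          (-Real.sin t • z.1 + Real.cos t • z.2) t :=
        ((Real.hasDerivAt_cos t).smul_const z.1).add ((Real.hasDerivAt_sin t).smul_const z.2)
      have e2 : HasDerivAt (fun t => -Real.sin t • z.1 + Real.cos t • z.2)
          (-Real.cos t • z.1 + -Real.sin t • z.2) t :=
        ((Real.hasDerivAt_sin t).neg.smul_const z.1).add ((Real.hasDerivAt_cos t).smul_const z.2)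
      have e3 : HasDerivAt (fun t => ⟪-Real.sin t • z.1 + Real.cos t • z.2, u⟫)
          (⟪-Real.cos t • z.1 + -Real.sin t • z.2, u⟫) t := by
        have := e2.inner ℝ (hasDerivAt_const t u)
        simpa using this
      exact ((hd _).comp_hasDerivAt t e1).mul e3)).2
  -- the integral is constant in `t`
  have hconst : ∀ t, ∫ z, Φ t z ∂(μ.prod μ) = ∫ z, Φ 0 z ∂(μ.prod μ) := by
    intro t
    have hrot := IsGaussian.map_rotation_eq_self_of_forall_strongDual_eq_zero hμ t
    conv_rhs => rw [← hrot]
    rw [integral_map (by fun_prop) (cΦ 0).aestronglyMeasurable]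
    refine integral_congr_ae (Filter.Eventually.of_forall fun z => ?_)
    simp [Φ, ContinuousLinearMap.rotation_apply]
  have hzero : ∫ z, Φ' 0 z ∂(μ.prod μ) = 0 := by
    have h2 : HasDerivAt (fun t => ∫ z, Φ t z ∂(μ.prod μ)) 0 0 := by
      rw [funext hconst]
      exact hasDerivAt_const _ _
    exact hder.unique h2
  have i1 : Integrable (fun z : H × H => G' z.1 z.2 * ⟪z.2, u⟫) (μ.prod μ) := by
    refine (hBint.const_mul (C' * ‖u‖)).mono' (by
      apply Continuous.aestronglyMeasurable; fun_prop)
      (Filter.Eventually.of_forall fun z => ?_)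
    have := bG'in 0 0 1 z (by simp) (by simp)
    simpa using this
  have i2 : Integrable (fun z : H × H => G z.1 * ⟪z.1, u⟫) (μ.prod μ) := by
    refine (hBint.const_mul (C * ‖u‖)).mono' (by
      apply Continuous.aestronglyMeasurable; fun_prop)
      (Filter.Eventually.of_forall fun z => ?_)
    have := bGin 0 1 0 z (by simp) (by simp)
    simpa using this
  have hsub : ∫ z : H × H, G' z.1 z.2 * ⟪z.2, u⟫ ∂(μ.prod μ)
      = ∫ z : H × H, G z.1 * ⟪z.1, u⟫ ∂(μ.prod μ) := by
    rw [← sub_eq_zero, ← integral_sub i1 i2, ← hzero]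
    refine integral_congr_ae (Filter.Eventually.of_forall fun z => ?_)
    simp [Φ', sub_eq_add_neg]
  rw [integral_prod _ i1, integral_prod _ i2] at hsub
  simp only [integral_const, probReal_univ, one_smul] at hsub
  rw [← hsub]
  refine integral_congr_ae (Filter.Eventually.of_forall fun x => ?_)
  -- covariance
  let g := (InnerProductSpace.toDual ℝ H).symm (G' x)
  have hg : ∀ y, G' x y = ⟪g, y⟫ := fun y =>
    (InnerProductSpace.toDual_symm_apply (x := y) (y := G' x)).symm
  simp only [hg]
  rw [real_inner_comm, ← hQ u g]
  refine integral_congr_ae (Filter.Eventually.of_forall fun y => ?_)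
  simp only [real_inner_comm g y]
  ring

end Meas

section Deriv
variable {H : Type*} [NormedAddCommGroup H] [InnerProductSpace ℝ H]

lemma PG.inner (a : H) : PG (fun x : H => ⟪x, a⟫) := by
  have := PG.clm (innerSL ℝ a) (PG.id (H := H))
  simpa [real_inner_comm] using this

lemma PG.mul_inner {G : H → ℝ} (hG : PG G) (a : H) : PG (fun x => G x * ⟪x, a⟫) :=
  hG.smul (PG.inner a)

lemma PG.deriv_mul_inner {G : H → ℝ} {G' : H → H →L[ℝ] ℝ} (hG : PG G) (hG' : PG G') (a : H) :
    PG (fun x => G x • innerSL ℝ a + ⟪x, a⟫ • G' x) :=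
  (hG.smul (PG.const _)).add ((PG.inner a).smul hG')

lemma hasFDerivAt_mul_inner {G : H → ℝ} {G' : H → H →L[ℝ] ℝ}
    (hd : ∀ x, HasFDerivAt G (G' x) x) (a x : H) :
    HasFDerivAt (fun x => G x * ⟪x, a⟫) (G x • innerSL ℝ a + ⟪x, a⟫ • G' x) x := by
  have h : HasFDerivAt (fun x : H => ⟪x, a⟫) (innerSL ℝ a) x := by
    have := (innerSL ℝ a).hasFDerivAt (x := x)
    refine this.congr_of_eventuallyEq (Filter.Eventually.of_forall fun y => ?_)
    simp [real_inner_comm]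
  exact (hd x).mul h

lemma PG.iterated {F : H → ℝ} (hF : ContDiff ℝ 3 F) {C p : ℝ} (hC : 0 ≤ C)
    (hb : ∀ k ≤ 3, ∀ x, ‖iteratedFDeriv ℝ k F x‖ ≤ C * (1 + ‖x‖) ^ p) {k : ℕ} (hk : k ≤ 3) :
    PG (iteratedFDeriv ℝ k F) := by
  refine ⟨hF.continuous_iteratedFDeriv (by exact_mod_cast hk), C, ⌈p⌉₊, hC, fun x => ?_⟩
  refine (hb k hk x).trans ?_
  gcongr
  rw [← Real.rpow_natCast]
  exact Real.rpow_le_rpow_of_exponent_le (by linarith [norm_nonneg x]) (Nat.le_ceil p)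

lemma exists_deriv {F : H → ℝ} (hF : ContDiff ℝ 3 F) {C p : ℝ} (hC : 0 ≤ C)
    (hb : ∀ k ≤ 3, ∀ x, ‖iteratedFDeriv ℝ k F x‖ ≤ C * (1 + ‖x‖) ^ p) {k : ℕ} (hk : k < 3)
    (m : Fin k → H) :
    PG (fun x => iteratedFDeriv ℝ k F x m) ∧ ∃ G' : H → H →L[ℝ] ℝ, PG G' ∧
      (∀ x, HasFDerivAt (fun x => iteratedFDeriv ℝ k F x m) (G' x) x) ∧
      ∀ x y, G' x y = iteratedFDeriv ℝ (k + 1) F x (Fin.cons y m) := by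
  let A := ContinuousMultilinearMap.apply ℝ (fun _ : Fin k => H) ℝ m
  refine ⟨PG.clm A (PG.iterated hF hC hb hk.le),
    fun x => A.comp (fderiv ℝ (iteratedFDeriv ℝ k F) x), ?_, fun x => ?_, fun x y => ?_⟩
  · have h1 : PG (iteratedFDeriv ℝ (k + 1) F) := PG.iterated hF hC hb hk
    have h2 : PG (fderiv ℝ (iteratedFDeriv ℝ k F)) := by
      obtain ⟨c1, D, N, hD, h1⟩ := h1
      refine ⟨?_, D, N, hD, fun x => ?_⟩
      · rw [fderiv_iteratedFDeriv]
        exact (LinearIsometryEquiv.continuous _).comp c1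
      · rw [norm_fderiv_iteratedFDeriv]
        exact h1 x
    exact PG.clm (ContinuousLinearMap.compL ℝ H _ ℝ A) h2
  · have hd := (hF.differentiable_iteratedFDeriv (m := k) (by exact_mod_cast hk)) x
    exact A.hasFDerivAt.comp x hd.hasFDerivAt
  · rw [iteratedFDeriv_succ_apply_left]
    simp [A, Fin.tail_cons]

end Deriv

end GaussIBP


/-- Gaussian integration by parts on a separable Hilbert space (third order):
if `μ` is a centred Gaussian measure on `H` with covariance operator `Q`, and
`F : H → ℝ` is `C³` with `‖d^k F(x)‖ ≤ C(1+‖x‖)^p` and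
`‖d^k F(x) − d^k F(y)‖ ≤ C(1+‖x‖+‖y‖)^p ‖x−y‖` for `0 ≤ k ≤ 3` (with `d⁰F = F`), then
`∫ F(x)(⟨x,u⟩⟨x,v⟩⟨x,w⟩ − ⟨Qu,v⟩⟨x,w⟩ − ⟨Qu,w⟩⟨x,v⟩ − ⟨Qv,w⟩⟨x,u⟩) dμ
  = ∫ d³F(x)(Qu,Qv,Qw) dμ`. -/
theorem stmt12 {H : Type*} [NormedAddCommGroup H] [InnerProductSpace ℝ H]
    [CompleteSpace H] [TopologicalSpace.SeparableSpace H]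
    [MeasurableSpace H] [BorelSpace H]
    (μ : Measure H) [IsProbabilityMeasure μ]
    (hgauss : ∀ L : H →L[ℝ] ℝ, ∃ var : ℝ≥0, μ.map L = gaussianReal 0 var)
    (Q : H →L[ℝ] H)
    (hQ : ∀ u' w' : H, ∫ x, ⟪x, u'⟫ * ⟪x, w'⟫ ∂μ = ⟪Q u', w'⟫)
    (u v w : H) (F : H → ℝ) (hF : ContDiff ℝ 3 F)
    (C p : ℝ) (hC : 0 ≤ C) (hp : 1 ≤ p)
    (hDF_bound : ∀ k ≤ 3, ∀ x, ‖iteratedFDeriv ℝ k F x‖ ≤ C * (1 + ‖x‖) ^ p)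
    (hDF_lip : ∀ k ≤ 3, ∀ x y, ‖iteratedFDeriv ℝ k F x - iteratedFDeriv ℝ k F y‖
      ≤ C * (1 + ‖x‖ + ‖y‖) ^ p * ‖x - y‖) :
    ∫ x, F x * (⟪x, u⟫ * ⟪x, v⟫ * ⟪x, w⟫ - ⟪Q u, v⟫ * ⟪x, w⟫
        - ⟪Q u, w⟫ * ⟪x, v⟫ - ⟪Q v, w⟫ * ⟪x, u⟫) ∂μ
      = ∫ x, iteratedFDeriv ℝ 3 F x ![Q u, Q v, Q w] ∂μ := by
  have : SecondCountableTopology H := UniformSpace.secondCountable_of_separable H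
  have hg : IsGaussian μ := isGaussian_of_map_eq_gaussianReal fun L => ⟨0, hgauss L⟩
  have hμ : ∀ L : StrongDual ℝ H, μ[L] = 0 := by
    intro L
    obtain ⟨s, hs⟩ := hgauss L
    have h : ∫ y, y ∂(μ.map L) = ∫ x, L x ∂μ :=
      integral_map (by fun_prop) (by fun_prop)
    rw [← h, hs]
    exact integral_id_gaussianReal
  have hsymm : ∀ a b : H, ⟪Q a, b⟫ = ⟪Q b, a⟫ := fun a b => by
    rw [← hQ, ← hQ]; simp only [mul_comm]
  obtain ⟨p0, G0, pG0, d0, e0⟩ := GaussIBP.exists_deriv hF hC hDF_bound (k := 0) (by norm_num) ![]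
  obtain ⟨p1, G1, pG1, d1, e1⟩ :=
    GaussIBP.exists_deriv hF hC hDF_bound (k := 1) (by norm_num) ![Q w]
  obtain ⟨p2, G2, pG2, d2, e2⟩ :=
    GaussIBP.exists_deriv hF hC hDF_bound (k := 2) (by norm_num) ![Q v, Q w]
  have e0' : ∀ x, G0 x (Q w) = iteratedFDeriv ℝ 1 F x ![Q w] := fun x => e0 x _
  have e1' : ∀ x, G1 x (Q v) = iteratedFDeriv ℝ 2 F x ![Q v, Q w] := fun x => e1 x _
  have e2' : ∀ x, G2 x (Q u) = iteratedFDeriv ℝ 3 F x ![Q u, Q v, Q w] := fun x => e2 x _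
  simp only [iteratedFDeriv_zero_apply] at p0 d0
  set F1 := fun x => iteratedFDeriv ℝ 1 F x ![Q w] with hF1
  set F2 := fun x => iteratedFDeriv ℝ 2 F x ![Q v, Q w] with hF2
  -- the five integrations by parts
  have I1 := GaussIBP.ibp hμ Q hQ ((p0.mul_inner u).mul_inner v)
    (GaussIBP.PG.deriv_mul_inner (p0.mul_inner u) (GaussIBP.PG.deriv_mul_inner p0 pG0 u) v)
    (GaussIBP.hasFDerivAt_mul_inner (GaussIBP.hasFDerivAt_mul_inner d0 u) v) w
  have I2 := GaussIBP.ibp hμ Q hQ p0 pG0 d0 w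
  have I3 := GaussIBP.ibp hμ Q hQ (p1.mul_inner u) (GaussIBP.PG.deriv_mul_inner p1 pG1 u)
    (GaussIBP.hasFDerivAt_mul_inner d1 u) v
  have I4 := GaussIBP.ibp hμ Q hQ p2 pG2 d2 u
  have q1 : Integrable (fun x => F x * ⟪x, u⟫) μ := (p0.mul_inner u).integrable
  have q2 : Integrable (fun x => F x * ⟪x, v⟫) μ := (p0.mul_inner v).integrable
  have q3 : Integrable (fun x => F x * ⟪x, w⟫) μ := (p0.mul_inner w).integrable
  have q4 : Integrable (fun x => F x * ⟪x, u⟫ * ⟪x, v⟫ * ⟪x, w⟫) μ :=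
    (((p0.mul_inner u).mul_inner v).mul_inner w).integrable
  have q5 : Integrable (fun x => F1 x * ⟪x, u⟫ * ⟪x, v⟫) μ :=
    ((p1.mul_inner u).mul_inner v).integrable
  have q6 : Integrable F1 μ := p1.integrable
  have q7 : Integrable (fun x => F2 x * ⟪x, u⟫) μ := (p2.mul_inner u).integrable
  have J1 : ∫ x, F x * ⟪x, u⟫ * ⟪x, v⟫ * ⟪x, w⟫ ∂μ = ⟪Q v, w⟫ * ∫ x, F x * ⟪x, u⟫ ∂μ
      + ⟪Q u, w⟫ * ∫ x, F x * ⟪x, v⟫ ∂μ + ∫ x, F1 x * ⟪x, u⟫ * ⟪x, v⟫ ∂μ := by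
    rw [I1, ← integral_const_mul, ← integral_const_mul,
      ← integral_add' (q1.const_mul _) (q2.const_mul _),
      ← integral_add' ((q1.const_mul _).add (q2.const_mul _)) q5]
    refine integral_congr_ae (Filter.Eventually.of_forall fun x => ?_)
    simp only [Pi.add_apply, add_apply, smul_apply, smul_eq_mul,
      innerSL_apply_apply, e0', real_inner_comm (Q w), hsymm w]
    ring
  have J3 : ∫ x, F1 x * ⟪x, u⟫ * ⟪x, v⟫ ∂μ = ⟪Q u, v⟫ * ∫ x, F1 x ∂μ
      + ∫ x, F2 x * ⟪x, u⟫ ∂μ := by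
    rw [I3, ← integral_const_mul, ← integral_add' (q6.const_mul _) q7]
    refine integral_congr_ae (Filter.Eventually.of_forall fun x => ?_)
    simp only [Pi.add_apply, add_apply, smul_apply, smul_eq_mul,
      innerSL_apply_apply, e1', real_inner_comm (Q v), hsymm v]
    ring
  have J0 : ∫ x, F x * (⟪x, u⟫ * ⟪x, v⟫ * ⟪x, w⟫ - ⟪Q u, v⟫ * ⟪x, w⟫
        - ⟪Q u, w⟫ * ⟪x, v⟫ - ⟪Q v, w⟫ * ⟪x, u⟫) ∂μ
      = ∫ x, F x * ⟪x, u⟫ * ⟪x, v⟫ * ⟪x, w⟫ ∂μ - ⟪Q u, v⟫ * ∫ x, F x * ⟪x, w⟫ ∂μ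
        - ⟪Q u, w⟫ * ∫ x, F x * ⟪x, v⟫ ∂μ - ⟪Q v, w⟫ * ∫ x, F x * ⟪x, u⟫ ∂μ := by
    rw [← integral_const_mul, ← integral_const_mul, ← integral_const_mul,
      ← integral_sub' q4 (q3.const_mul _),
      ← integral_sub' (q4.sub (q3.const_mul _)) (q2.const_mul _),
      ← integral_sub' ((q4.sub (q3.const_mul _)).sub (q2.const_mul _)) (q1.const_mul _)]
    refine integral_congr_ae (Filter.Eventually.of_forall fun x => ?_)
    simp only [Pi.sub_apply]
    ring
  simp only [e0'] at I2
  simp only [e2'] at I4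
  rw [J0, J1, J3, I2, ← I4]
  ring
end
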